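/- arXiv:2111.01062 — 2 statements merged into one kernel-verified Lean document; each statement's English description precedes it below -/
import Mathlib

section
/- Let d=2 and let V:ℤ^2→ℂ be Γ-periodic. If the Laurent polynomial z↦𝒫_V(z,[V]) is reducible, then 𝒫_V(z,[V]) = (−1)^{q_2}z_1^{q_2}+(−1)^{q_2}z_1^{−q_2}+(−1)^{q_1}z_2^{q_1}+(−1)^{q_1}z_2^{−q_1}, which equals 𝒫_0(z,0) for the zero potential 0. -/
noncomputable section

/-- The discrete Laplacian on `ℤ^d`: `(Δu)(n) = Σ_{‖n'-n‖₁ = 1} u(n')`. -/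
def discLap {d : ℕ} (u : (Fin d → ℤ) → ℂ) (n : Fin d → ℤ) : ℂ :=
  ∑ j : Fin d, (u (Function.update n j (n j + 1)) + u (Function.update n j (n j - 1)))

/-- Reduction of an integer modulo `q`, as an element of `Fin q`. -/
def fem (q : ℕ+) (a : ℤ) : Fin (q : ℕ) :=
  ⟨(a % ((q : ℕ) : ℤ)).toNat, by
    have hq : (0:ℤ) < ((q : ℕ) : ℤ) := by exact_mod_cast q.pos
    have h1 : 0 ≤ a % ((q : ℕ) : ℤ) := Int.emod_nonneg a (ne_of_gt hq)
    have h2 : a % ((q : ℕ) : ℤ) < ((q : ℕ) : ℤ) := Int.emod_lt_of_pos a hq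
    omega⟩

/-- Extension of a function on the fundamental domain `W` to `ℤ^d` using the
Floquet boundary conditions `u(n + qⱼ eⱼ) = zⱼ u(n)`. -/
def extendBC {d : ℕ} (q : Fin d → ℕ+) (z : Fin d → ℂ)
    (u : (∀ j, Fin ((q j : ℕ))) → ℂ) : (Fin d → ℤ) → ℂ :=
  fun n => (∏ j, z j ^ (n j / ((q j : ℕ) : ℤ))) * u (fun j => fem (q j) (n j))

/-- The matrix `D_V(z)` of the Floquet reduction of `-Δ + V` to the fundamental domain. -/
def DVmat {d : ℕ} (q : Fin d → ℕ+) (V : (Fin d → ℤ) → ℂ) (z : Fin d → ℂ) :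
    Matrix (∀ j, Fin ((q j : ℕ))) (∀ j, Fin ((q j : ℕ))) ℂ :=
  fun n n' =>
    -(discLap (extendBC q z (Pi.single n' 1)) (fun j => ((n j : ℕ) : ℤ)))
      + V (fun j => ((n j : ℕ) : ℤ)) * (if n = n' then 1 else 0)

/-- `𝒫_V(z, λ) = det(D_V(z) - λ I)`. -/
def scriptP {d : ℕ} (q : Fin d → ℕ+) (V : (Fin d → ℤ) → ℂ) (z : Fin d → ℂ)
    (lam : ℂ) : ℂ :=
  Matrix.det (DVmat q V z - lam • (1 : Matrix (∀ j, Fin ((q j : ℕ))) (∀ j, Fin ((q j : ℕ))) ℂ))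

/-- `Γ`-periodicity for a complex-valued function on `ℤ^d`. -/
def IsPeriodic {d : ℕ} (q : Fin d → ℕ+) (V : (Fin d → ℤ) → ℂ) : Prop :=
  ∀ (n : Fin d → ℤ) (j : Fin d), V (Function.update n j (n j + ((q j : ℕ) : ℤ))) = V n

/-- `Γ`-periodicity for a real-valued function on `ℤ^d`. -/
def IsPeriodicR {d : ℕ} (q : Fin d → ℕ+) (V : (Fin d → ℤ) → ℝ) : Prop :=
  ∀ (n : Fin d → ℤ) (j : Fin d), V (Function.update n j (n j + ((q j : ℕ) : ℤ))) = V n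

/-- `ρ_m = e^{2πi m / q}`. -/
def rho (q : ℕ+) (m : ℕ) : ℂ :=
  Complex.exp (2 * (Real.pi : ℂ) * Complex.I * (m : ℂ) / ((q : ℕ) : ℂ))

/-- The discrete Fourier transform `V̂(l)` of a periodic potential. -/
def dft {d : ℕ} (q : Fin d → ℕ+) (V : (Fin d → ℤ) → ℂ) (l : Fin d → ℤ) : ℂ :=
  (1 / ((∏ j, (q j : ℕ) : ℕ) : ℂ)) * ∑ n : (∀ j, Fin ((q j : ℕ))),
    V (fun j => ((n j : ℕ) : ℤ)) *
      Complex.exp (-(2 * (Real.pi : ℂ) * Complex.I) * ∑ j, (l j : ℂ) * ((n j : ℕ) : ℂ) / ((q j : ℕ) : ℂ))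

/-- The diagonal matrix `A(z)` with entries `-Σⱼ (ρʲ_{nⱼ} zⱼ + 1/(ρʲ_{nⱼ} zⱼ))`. -/
def Amat {d : ℕ} (q : Fin d → ℕ+) (z : Fin d → ℂ) :
    Matrix (∀ j, Fin ((q j : ℕ))) (∀ j, Fin ((q j : ℕ))) ℂ :=
  Matrix.diagonal fun n => -(∑ j, (rho (q j) (n j) * z j + (rho (q j) (n j) * z j)⁻¹))

/-- The matrix `B_V` with entries `V̂(n - n')`. -/
def Bmat {d : ℕ} (q : Fin d → ℕ+) (V : (Fin d → ℤ) → ℂ) :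
    Matrix (∀ j, Fin ((q j : ℕ))) (∀ j, Fin ((q j : ℕ))) ℂ :=
  fun n n' => dft q V (fun j => ((n j : ℕ) : ℤ) - ((n' j : ℕ) : ℤ))

/-- The average `[V]` of a periodic potential. -/
def avgPot {d : ℕ} (q : Fin d → ℕ+) (V : (Fin d → ℤ) → ℂ) : ℂ :=
  (1 / ((∏ j, (q j : ℕ) : ℕ) : ℂ)) * ∑ n : (∀ j, Fin ((q j : ℕ))), V (fun j => ((n j : ℕ) : ℤ))

/-- The Fermi variety `F_λ(V)`. -/
def FermiVariety {d : ℕ} (q : Fin d → ℕ+) (V : (Fin d → ℤ) → ℂ) (lam : ℂ) :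
    Set (Fin d → ℂ) :=
  {k | ∃ u : (Fin d → ℤ) → ℂ, u ≠ 0 ∧
    (∀ n, -(discLap u n) + V n * u n = lam * u n) ∧
    (∀ (n : Fin d → ℤ) (j : Fin d),
      u (Function.update n j (n j + ((q j : ℕ) : ℤ)))
        = Complex.exp (2 * (Real.pi : ℂ) * Complex.I * k j) * u n)}

/-- Floquet isospectrality of two real periodic potentials. -/
def FloquetIso {d : ℕ} (q : Fin d → ℕ+) (V Y : (Fin d → ℤ) → ℝ) : Prop :=
  ∀ k : Fin d → ℝ,
    spectrum ℂ (DVmat q (fun n => ((V n : ℝ) : ℂ))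
        (fun j => Complex.exp (2 * (Real.pi : ℂ) * Complex.I * (k j : ℂ))))
      = spectrum ℂ (DVmat q (fun n => ((Y n : ℝ) : ℂ))
        (fun j => Complex.exp (2 * (Real.pi : ℂ) * Complex.I * (k j : ℂ))))

/-- A function on `(ℂ^*)^d` given by a Laurent polynomial. -/
def IsLaurent {d : ℕ} (f : (Fin d → ℂ) → ℂ) : Prop :=
  ∃ c : (Fin d → ℤ) →₀ ℂ, ∀ z : Fin d → ℂ, (∀ j, z j ≠ 0) →
    f z = c.sum fun a C => C * ∏ j, z j ^ a j

/-- A Laurent monomial `C z₁^{a₁} ⋯ z_d^{a_d}` with `C ≠ 0`. -/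
def IsMonomial {d : ℕ} (f : (Fin d → ℂ) → ℂ) : Prop :=
  ∃ (C : ℂ) (a : Fin d → ℤ), C ≠ 0 ∧ ∀ z : Fin d → ℂ, (∀ j, z j ≠ 0) →
    f z = C * ∏ j, z j ^ a j

/-- Irreducibility of a Laurent polynomial: no factorization into two non-monomial
Laurent polynomials. -/
def LaurentIrreducible {d : ℕ} (h : (Fin d → ℂ) → ℂ) : Prop :=
  ¬ ∃ f g : (Fin d → ℂ) → ℂ, IsLaurent f ∧ IsLaurent g ∧
      ¬ IsMonomial f ∧ ¬ IsMonomial g ∧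
      ∀ z : Fin d → ℂ, (∀ j, z j ≠ 0) → h z = f z * g z

open AddMonoidAlgebra in
/-- Factors of a nonzero product have extremal exponents, for the lexicographic order given by a
jointly injective pair of integer weights, whose sum is an exponent of the product. -/
theorem AddMonoidAlgebra.exists_lex_max_add_mem_support {G : Type*} [AddCommGroup G]
    (u v : G →+ ℤ) (huv : ∀ x, u x = 0 → v x = 0 → x = 0) {F H : AddMonoidAlgebra ℂ G}
    (hF : F ≠ 0) (hH : H ≠ 0) :
    ∃ a ∈ F.coeff.support, ∃ b ∈ H.coeff.support, a + b ∈ (F * H).coeff.support ∧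
      (∀ a' ∈ F.coeff.support, u a' < u a ∨ u a' = u a ∧ v a' ≤ v a) ∧
      ∀ b' ∈ H.coeff.support, u b' < u b ∨ u b' = u b ∧ v b' ≤ v b := by
  have key : ∀ {E : AddMonoidAlgebra ℂ G}, E ≠ 0 → ∃ a ∈ E.coeff.support,
      ∀ a' ∈ E.coeff.support, u a' < u a ∨ u a' = u a ∧ v a' ≤ v a := by
    intro E hE
    have hne : E.coeff.support.Nonempty := by
      rw [Finsupp.support_nonempty_iff]
      simpa using hE
    obtain ⟨a, ha, hmax⟩ := Finset.exists_max_image E.coeff.support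
      (fun a => toLex (u a, v a)) hne
    refine ⟨a, ha, fun a' ha' => ?_⟩
    have := hmax a' ha'
    rwa [Prod.Lex.toLex_le_toLex] at this
  obtain ⟨a, ha, hamax⟩ := key hF
  obtain ⟨b, hb, hbmax⟩ := key hH
  refine ⟨a, ha, b, hb, ?_, hamax, hbmax⟩
  have huniq : UniqueAdd F.coeff.support H.coeff.support a b := by
    intro a' b' ha' hb' hab
    have h1 := hamax a' ha'
    have h2 := hbmax b' hb'
    have hu : u a' + u b' = u a + u b := by rw [← map_add, ← map_add, hab]
    have hv : v a' + v b' = v a + v b := by rw [← map_add, ← map_add, hab]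
    constructor
    · rw [← sub_eq_zero]
      apply huv <;> rw [map_sub] <;> omega
    · rw [← sub_eq_zero]
      apply huv <;> rw [map_sub] <;> omega
  rw [Finsupp.mem_support_iff, coeff_mul_add_of_uniqueAdd huniq]
  exact mul_ne_zero (Finsupp.mem_support_iff.1 ha) (Finsupp.mem_support_iff.1 hb)

theorem AddMonoidAlgebra.exists_add_of_mem_support_mul {G : Type*} [AddCommGroup G]
    {F H : AddMonoidAlgebra ℂ G} {c : G} (hc : c ∈ (F * H).coeff.support) :
    ∃ a ∈ F.coeff.support, ∃ b ∈ H.coeff.support, a + b = c := by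
  classical
  exact Finset.mem_add.1 (support_coeff_mul_subset F H hc)

/-- The integer linear form `(k₀, k₁) ↦ a k₀ + b k₁`. -/
def linForm (a b : ℤ) : (Fin 2 → ℤ) →+ ℤ where
  toFun k := a * k 0 + b * k 1
  map_zero' := by simp
  map_add' x y := by simp; ring

@[simp] theorem linForm_apply (a b : ℤ) (k : Fin 2 → ℤ) : linForm a b k = a * k 0 + b * k 1 := rfl

theorem exists_eq_mul_of_linForm_eq {p r : ℤ} (hr : r ≠ 0) (hc : IsCoprime p r)
    {x y : ℤ} (h : p * x + r * y = 0) : ∃ k, x = r * k ∧ y = -(p * k) := by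
  have hdvd : r ∣ x := hc.symm.dvd_of_dvd_mul_left ⟨-y, by linarith⟩
  obtain ⟨k, rfl⟩ := hdvd
  refine ⟨k, rfl, ?_⟩
  apply mul_left_cancel₀ hr
  linarith

/-- If the first factor realises the full width in the weight `v` that is allowed for the product,
then all exponents of the product are extremal for the weight `u`. -/
theorem AddMonoidAlgebra.weight_eq_or_eq_neg_of_mul {G : Type*} [AddCommGroup G]
    {u v : G →+ ℤ} {Q : ℤ} (hQ0 : 0 < Q) (inj : ∀ x, u x = 0 → v x = 0 → x = 0)
    (div2 : ∀ x y, v x = v y → ∃ k, u x - u y = 2 * Q * k)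
    {F H : AddMonoidAlgebra ℂ G} (hF0 : F ≠ 0) (hH0 : H ≠ 0) (hH : H.coeff.support.Nontrivial)
    (h1 : ∀ a ∈ (F * H).coeff.support, |u a| ≤ Q) (h2 : ∀ a ∈ (F * H).coeff.support, |v a| ≤ Q)
    {a₁ a₂ b₁ : G} (ha₁ : a₁ ∈ F.coeff.support) (ha₂ : a₂ ∈ F.coeff.support)
    (hb₁ : b₁ ∈ H.coeff.support) (hma : ∀ a ∈ F.coeff.support, u a ≤ u a₁)
    (hmb : ∀ b ∈ H.coeff.support, u b ≤ u b₁) (hQab : u a₁ + u b₁ = Q)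
    (hv2 : v a₁ - v a₂ = 2 * Q) :
    ∀ a ∈ (F * H).coeff.support, u a = Q ∨ u a = -Q := by
  intro c hc
  obtain ⟨a₃, ha₃, b₃, hb₃, hab₃, hma₃, hmb₃⟩ :=
    exists_lex_max_add_mem_support v u (fun x h h' => inj x h' h) hF0 hH0
  obtain ⟨a₄, ha₄, b₄, hb₄, hab₄, hma₄, hmb₄⟩ :=
    exists_lex_max_add_mem_support (-v) u (fun x h h' => inj x h' (by simpa using h)) hF0 hH0
  obtain ⟨a₅, ha₅, b₅, hb₅, hab₅, hma₅, hmb₅⟩ :=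
    exists_lex_max_add_mem_support (-u) v (fun x h h' => inj x (by simpa using h) h') hF0 hH0
  simp only [AddMonoidHom.neg_apply] at hma₄ hmb₄ hma₅ hmb₅
  have r3 := h2 _ hab₃
  have r4 := h2 _ hab₄
  have r5 := h1 _ hab₅
  rw [abs_le, map_add] at r3 r4 r5
  have s1 := hma₃ _ ha₁
  have s2 := hma₄ _ ha₂
  have hvH : ∀ b ∈ H.coeff.support, v b = v b₃ := by
    intro b hb
    have := hmb₃ _ hb
    have := hmb₄ _ hb
    have := hmb₄ _ hb₃
    omega
  have hgap : ∃ b ∈ H.coeff.support, ∃ b' ∈ H.coeff.support, u b' + 2 * Q ≤ u b := by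
    obtain ⟨b, hb, b', hb', hne⟩ := hH
    obtain ⟨m, hm⟩ := div2 b b' (by rw [hvH b hb, hvH b' hb'])
    have hm0 : m ≠ 0 := by
      rintro rfl
      apply hne
      rw [← sub_eq_zero]
      apply inj
      · rw [map_sub, hm, mul_zero]
      · rw [map_sub, hvH b hb, hvH b' hb', sub_self]
    rcases lt_or_gt_of_ne hm0 with h | h
    · exact ⟨b', hb', b, hb, by nlinarith⟩
    · exact ⟨b, hb, b', hb', by nlinarith⟩
  obtain ⟨b, hb, b', hb', hbb⟩ := hgap
  have t1 := hmb _ hb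
  have t2 := hmb₅ _ hb'
  have t3 := hma _ ha₅
  obtain ⟨a, ha, d, hd, rfl⟩ := exists_add_of_mem_support_mul hc
  have t4 := hma _ ha
  have t5 := hma₅ _ ha
  have t6 := hmb₅ _ hd
  have t7 := hmb _ hd
  obtain ⟨m, hm⟩ := div2 b₁ d (by rw [hvH b₁ hb₁, hvH d hd])
  have hm0 : 0 ≤ m := nonneg_of_mul_nonneg_right (show 0 ≤ 2 * Q * m by omega) (by omega)
  have hm1 : m ≤ 1 := by
    by_contra hcon
    have : 2 * Q * 2 ≤ 2 * Q * m := mul_le_mul_of_nonneg_left (by omega) (by omega)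
    omega
  rw [map_add]
  obtain rfl | rfl : m = 0 ∨ m = 1 := by omega
  · left; omega
  · right; omega

theorem AddMonoidAlgebra.linForm_eq_or_eq_neg_of_mul {p r : ℤ} (hp : 0 < p) (hr : 0 < r)
    (hc : IsCoprime p r) {F H : AddMonoidAlgebra ℂ (Fin 2 → ℤ)}
    (h1 : ∀ a ∈ (F * H).coeff.support, |linForm p r a| ≤ p * r)
    (h2 : ∀ a ∈ (F * H).coeff.support, |linForm p (-r) a| ≤ p * r)
    (hE : ![r, 0] ∈ (F * H).coeff.support) (hN : ![0, p] ∈ (F * H).coeff.support)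
    (hF : F.coeff.support.Nontrivial) (hH : H.coeff.support.Nontrivial) :
    ∀ a ∈ (F * H).coeff.support, linForm p r a = p * r ∨ linForm p r a = -(p * r) := by
  set Q := p * r with hQ
  have hQ0 : 0 < Q := mul_pos hp hr
  have hF0 : F ≠ 0 := by rintro rfl; simp at hE
  have hH0 : H ≠ 0 := by rintro rfl; simp at hE
  set u := linForm p r with hu
  set v := linForm p (-r) with hv
  have inj : ∀ x, u x = 0 → v x = 0 → x = 0 := by
    intro x h1 h2
    simp only [hu, hv, linForm_apply] at h1 h2
    have e0 : x 0 = 0 := by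
      have : p * x 0 = 0 := by linarith
      simpa [hp.ne'] using this
    have e1 : x 1 = 0 := by
      have : r * x 1 = 0 := by linarith
      simpa [hr.ne'] using this
    ext i; fin_cases i <;> simp [e0, e1]
  have div1 : ∀ x y, u x = u y → ∃ k, v x - v y = 2 * Q * k := by
    intro x y h
    simp only [hu, hv, linForm_apply] at h ⊢
    obtain ⟨k, hk, hk'⟩ := exists_eq_mul_of_linForm_eq (x := x 0 - y 0) (y := x 1 - y 1)
      hr.ne' hc (by linarith)
    refine ⟨k, ?_⟩
    have : p * (x 0 - y 0) - r * (x 1 - y 1) = 2 * (p * r) * k := by rw [hk, hk']; ring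
    rw [hQ]; linarith
  have div2 : ∀ x y, v x = v y → ∃ k, u x - u y = 2 * Q * k := by
    intro x y h
    simp only [hu, hv, linForm_apply] at h ⊢
    obtain ⟨k, hk, hk'⟩ := exists_eq_mul_of_linForm_eq (x := x 0 - y 0) (y := y 1 - x 1)
      hr.ne' hc (by linarith)
    refine ⟨k, ?_⟩
    have : p * (x 0 - y 0) - r * (y 1 - x 1) = 2 * (p * r) * k := by rw [hk, hk']; ring
    rw [hQ]; linarith
  have uE : u ![r, 0] = Q := by simp [hu, hQ]
  have vE : v ![r, 0] = Q := by simp [hv, hQ]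
  have uN : u ![0, p] = Q := by simp [hu, hQ, mul_comm]
  have vN : v ![0, p] = -Q := by simp [hv, hQ, mul_comm]
  clear_value u v Q
  -- `k + l = 1` tells which factor carries the edge from `(r, 0)` to `(0, p)`
  obtain ⟨a₁, ha₁, b₁, hb₁, hab₁, hma₁, hmb₁⟩ :=
    exists_lex_max_add_mem_support u v inj hF0 hH0
  obtain ⟨a₂, ha₂, b₂, hb₂, hab₂, hma₂, hmb₂⟩ :=
    exists_lex_max_add_mem_support u (-v) (fun x h h' => inj x h (by simpa using h')) hF0 hH0
  have h1' := h1 _ hab₁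
  have h2' := h2 _ hab₁
  have h1'' := h1 _ hab₂
  have h2'' := h2 _ hab₂
  obtain ⟨aE, haE, bE, hbE, habE⟩ := exists_add_of_mem_support_mul hE
  obtain ⟨aN, haN, bN, hbN, habN⟩ := exists_add_of_mem_support_mul hN
  rw [← habE, map_add] at uE vE
  rw [← habN, map_add] at uN vN
  rw [abs_le, map_add] at h1' h2' h1'' h2''
  simp only [AddMonoidHom.neg_apply] at hma₂ hmb₂
  have q1 := hma₁ _ haE
  have q2 := hmb₁ _ hbE
  have q3 := hma₂ _ haN
  have q4 := hmb₂ _ hbN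
  have q5 := hma₁ _ ha₂
  have q6 := hmb₁ _ hb₂
  have q7 := hma₂ _ ha₁
  have q8 := hmb₂ _ hb₁
  obtain ⟨k, hk⟩ := div1 a₁ a₂ (by omega)
  obtain ⟨l, hl⟩ := div1 b₁ b₂ (by omega)
  have e1 : u a₁ + u b₁ = Q := by omega
  have hkl : 2 * Q * k + 2 * Q * l = 2 * Q := by omega
  have hk0 : 0 ≤ 2 * Q * k := by omega
  have hl0 : 0 ≤ 2 * Q * l := by omega
  have hk0' : 0 ≤ k := nonneg_of_mul_nonneg_right hk0 (by omega)
  have hl0' : 0 ≤ l := nonneg_of_mul_nonneg_right hl0 (by omega)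
  have hkl' : k + l = 1 := by
    apply mul_left_cancel₀ (show 2 * Q ≠ 0 by omega); linarith
  rcases (show k = 1 ∨ l = 1 by omega) with rfl | rfl
  · exact weight_eq_or_eq_neg_of_mul hQ0 inj div2 hF0 hH0 hH h1 h2 ha₁ ha₂ hb₁
      (fun a ha => by have := hma₁ a ha; omega)
      (fun b hb => by have := hmb₁ b hb; omega) e1 (by omega)
  · rw [mul_comm F H] at h1 h2 ⊢
    exact weight_eq_or_eq_neg_of_mul hQ0 inj div2 hH0 hF0 hF h1 h2 hb₁ hb₂ ha₁
      (fun b hb => by have := hmb₁ b hb; omega)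
      (fun a ha => by have := hma₁ a ha; omega) (by omega) (by omega)

/-- A rhombus with primitive edges meets the lines carrying two opposite edges in its vertices. -/
theorem eq_vertex_of_linForm_eq {p r : ℤ} (hp : 0 < p) (hr : 0 < r) (hc : IsCoprime p r)
    {a : Fin 2 → ℤ} (h1 : linForm p r a = p * r ∨ linForm p r a = -(p * r))
    (h2 : |linForm p (-r) a| ≤ p * r) :
    a = ![r, 0] ∨ a = ![-r, 0] ∨ a = ![0, p] ∨ a = ![0, -p] := by
  have hQ0 : 0 < p * r := mul_pos hp hr
  rw [abs_le] at h2
  simp only [linForm_apply] at h1 h2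
  rcases h1 with h1 | h1
  · obtain ⟨k, hk, hk'⟩ := exists_eq_mul_of_linForm_eq (x := a 0) (y := a 1 - p)
      hr.ne' hc (by linarith)
    have hk1 : a 1 = p - p * k := by linarith
    rw [hk, hk1] at h2
    have hlo : 0 ≤ k := by
      by_contra hcon
      nlinarith [mul_le_mul_of_nonneg_left (show k ≤ -1 by omega) hQ0.le]
    have hhi : k ≤ 1 := by
      by_contra hcon
      nlinarith [mul_le_mul_of_nonneg_left (show 2 ≤ k by omega) hQ0.le]
    obtain rfl | rfl : k = 0 ∨ k = 1 := by omega
    · right; right; left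
      ext i; fin_cases i <;> simp [hk, hk1]
    · left
      ext i; fin_cases i <;> simp [hk, hk1]
  · obtain ⟨k, hk, hk'⟩ := exists_eq_mul_of_linForm_eq (x := a 0) (y := a 1 + p)
      hr.ne' hc (by linarith)
    have hk1 : a 1 = -p - p * k := by linarith
    rw [hk, hk1] at h2
    have hlo : -1 ≤ k := by
      by_contra hcon
      nlinarith [mul_le_mul_of_nonneg_left (show k ≤ -2 by omega) hQ0.le]
    have hhi : k ≤ 0 := by
      by_contra hcon
      nlinarith [mul_le_mul_of_nonneg_left (show 1 ≤ k by omega) hQ0.le]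
    obtain rfl | rfl : k = 0 ∨ k = -1 := by omega
    · right; right; right
      ext i; fin_cases i <;> simp [hk, hk1]
    · right; left
      ext i; fin_cases i <;> simp [hk, hk1]

/-- The character `z ↦ ∏ⱼ zⱼ ^ aⱼ` of the complex torus, as a function of the exponent `a`. -/
def torusChar {d : ℕ} (z : Fin d → ℂˣ) : Multiplicative (Fin d → ℤ) →* ℂ where
  toFun a := ∏ j, (z j : ℂ) ^ (a.toAdd j)
  map_one' := by simp
  map_mul' a b := by
    simp [← Finset.prod_mul_distrib, zpow_add₀ (Units.ne_zero _)]

/-- Evaluation of a formal Laurent polynomial at a point of the torus. -/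
def laurentEval {d : ℕ} (z : Fin d → ℂˣ) : AddMonoidAlgebra ℂ (Fin d → ℤ) →ₐ[ℂ] ℂ :=
  AddMonoidAlgebra.lift ℂ ℂ (Fin d → ℤ) (torusChar z)

theorem laurentEval_apply {d : ℕ} (z : Fin d → ℂˣ) (x : AddMonoidAlgebra ℂ (Fin d → ℤ)) :
    laurentEval z x = x.coeff.sum fun a C => C * ∏ j, (z j : ℂ) ^ a j := by
  rw [laurentEval, AddMonoidAlgebra.lift_apply]
  rfl

@[simp] theorem laurentEval_single {d : ℕ} (z : Fin d → ℂˣ) (a : Fin d → ℤ) (C : ℂ) :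
    laurentEval z (AddMonoidAlgebra.single a C) = C * ∏ j, (z j : ℂ) ^ a j := by
  rw [laurentEval, AddMonoidAlgebra.lift_single]
  rfl

theorem eq_zero_of_laurentEval_eq_zero {d : ℕ} {x : AddMonoidAlgebra ℂ (Fin d → ℤ)}
    (hx : ∀ z, laurentEval z x = 0) : x = 0 := by
  let χ : (Fin d → ℤ) → ((Fin d → ℂˣ) →* ℂ) := fun a =>
    { toFun := fun z => ∏ j, (z j : ℂ) ^ a j
      map_one' := by simp
      map_mul' := fun z w => by simp [← Finset.prod_mul_distrib, mul_zpow] }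
  have hχ : Function.Injective χ := by
    intro a b hab
    funext i
    have h2 : (2 : ℂ) ≠ 0 := two_ne_zero
    have h := DFunLike.congr_fun hab (Pi.mulSingle i (Units.mk0 2 h2))
    have aux : ∀ c : Fin d → ℤ, χ c (Pi.mulSingle i (Units.mk0 2 h2)) = 2 ^ c i := by
      intro c
      change ∏ j, ((Pi.mulSingle i (Units.mk0 2 h2) : Fin d → ℂˣ) j : ℂ) ^ c j = 2 ^ c i
      rw [Finset.prod_eq_single i]
      · simp
      · intro j _ hj
        simp [Pi.mulSingle_eq_of_ne hj]
      · simp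
    rw [aux, aux] at h
    have h' : (2 : ℝ) ^ a i = (2 : ℝ) ^ b i := by simpa using congrArg norm h
    exact zpow_right_injective₀ (by norm_num) (by norm_num) h'
  have hli := (linearIndependent_monoidHom (Fin d → ℂˣ) ℂ).comp χ hχ
  rw [linearIndependent_iff] at hli
  rw [← AddMonoidAlgebra.coeff_eq_zero]
  apply hli
  funext z
  rw [Finsupp.linearCombination_apply, Finsupp.sum_apply']
  have := hx z
  rw [laurentEval_apply] at this
  simp only [Function.comp_apply, Finsupp.sum, Pi.smul_apply, smul_eq_mul]
  exact this

/-- The formal Laurent polynomials all of whose exponents have weight at most `b`. -/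
def weightLE {G : Type*} [AddCommGroup G] (φ : G →+ ℤ) (b : ℤ) :
    Submodule ℂ (AddMonoidAlgebra ℂ G) where
  carrier := {x | ∀ a ∈ x.coeff.support, φ a ≤ b}
  zero_mem' := by simp
  add_mem' {x y} hx hy a ha := by
    classical
    rcases Finset.mem_union.1 (Finsupp.support_add ha) with h | h
    exacts [hx a h, hy a h]
  smul_mem' c x hx a ha := hx a (Finsupp.support_smul ha)

section weightLE

variable {G : Type*} [AddCommGroup G] {φ : G →+ ℤ}

theorem coeff_eq_zero_of_mem_weightLE {b : ℤ} {x : AddMonoidAlgebra ℂ G} (hx : x ∈ weightLE φ b)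
    {a : G} (ha : b < φ a) : x.coeff a = 0 := by
  by_contra h
  exact (hx a (Finsupp.mem_support_iff.2 h)).not_gt ha

theorem weightLE_mono {b c : ℤ} (h : b ≤ c) : weightLE φ b ≤ weightLE φ c :=
  fun _ hx a ha => (hx a ha).trans h

theorem single_mem_weightLE {a : G} {b : ℤ} (h : φ a ≤ b) (c : ℂ) :
    AddMonoidAlgebra.single a c ∈ weightLE φ b := by
  intro a' ha'
  rw [AddMonoidAlgebra.coeff_single] at ha'
  rw [Finset.mem_singleton.1 (Finsupp.support_single_subset ha')]
  exact h

theorem mul_mem_weightLE {b c : ℤ} {x y : AddMonoidAlgebra ℂ G} (hx : x ∈ weightLE φ b)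
    (hy : y ∈ weightLE φ c) : x * y ∈ weightLE φ (b + c) := by
  intro a ha
  obtain ⟨a₁, h₁, a₂, h₂, rfl⟩ := AddMonoidAlgebra.exists_add_of_mem_support_mul ha
  rw [map_add]
  exact add_le_add (hx _ h₁) (hy _ h₂)

theorem one_mem_weightLE : (1 : AddMonoidAlgebra ℂ G) ∈ weightLE φ 0 :=
  single_mem_weightLE (by simp) 1

theorem prod_mem_weightLE {ι : Type*} (s : Finset ι) {f : ι → AddMonoidAlgebra ℂ G} {b : ι → ℤ}
    (h : ∀ i ∈ s, f i ∈ weightLE φ (b i)) : ∏ i ∈ s, f i ∈ weightLE φ (∑ i ∈ s, b i) := by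
  classical
  induction s using Finset.induction_on with
  | empty => simpa using one_mem_weightLE
  | insert i s hi ih =>
    rw [Finset.prod_insert hi, Finset.sum_insert hi]
    exact mul_mem_weightLE (h i (by simp)) (ih fun j hj => h j (by simp [hj]))

theorem prod_add_sub_prod_mem_weightLE {ι : Type*} (s : Finset ι)
    {f g : ι → AddMonoidAlgebra ℂ G} {b : ι → ℤ} (hf : ∀ i ∈ s, f i ∈ weightLE φ (b i))
    (hg : ∀ i ∈ s, g i ∈ weightLE φ (b i - 1)) :
    ∏ i ∈ s, (f i + g i) - ∏ i ∈ s, f i ∈ weightLE φ (∑ i ∈ s, b i - 1) := by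
  classical
  induction s using Finset.induction_on with
  | empty => simp
  | insert i s hi ih =>
    rw [Finset.prod_insert hi, Finset.prod_insert hi, Finset.sum_insert hi]
    have e : (f i + g i) * ∏ j ∈ s, (f j + g j) - f i * ∏ j ∈ s, f j =
        (f i + g i) * (∏ j ∈ s, (f j + g j) - ∏ j ∈ s, f j) + g i * ∏ j ∈ s, f j := by ring
    rw [e]
    refine add_mem ?_ ?_
    · refine weightLE_mono (le_of_eq (by ring)) (mul_mem_weightLE (b := b i) ?_
        (ih (fun j hj => hf j (by simp [hj])) fun j hj => hg j (by simp [hj])))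
      exact add_mem (hf i (by simp)) (weightLE_mono (by omega) (hg i (by simp)))
    · refine weightLE_mono (le_of_eq (by ring)) (mul_mem_weightLE (hg i (by simp))
        (prod_mem_weightLE s fun j hj => hf j (by simp [hj])))

variable {ι : Type*} [Fintype ι] {ψ : ι → ℤ} {b : ℤ}

theorem sum_add_sub_perm (σ : Equiv.Perm ι) :
    ∑ i, (b + ψ (σ i) - ψ i) = Fintype.card ι * b := by
  rw [Finset.sum_sub_distrib, Finset.sum_add_distrib, Equiv.sum_comp σ ψ]
  simp

variable [DecidableEq ι]

theorem det_mem_weightLE {M : Matrix ι ι (AddMonoidAlgebra ℂ G)}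
    (hM : ∀ i j, M i j ∈ weightLE φ (b + ψ i - ψ j)) :
    M.det ∈ weightLE φ (Fintype.card ι * b) := by
  rw [Matrix.det_apply]
  refine sum_mem fun σ _ => ?_
  rw [Units.smul_def]
  refine zsmul_mem ?_ _
  rw [← sum_add_sub_perm (ψ := ψ) σ]
  exact prod_mem_weightLE _ fun i _ => hM _ _

theorem det_add_sub_det_mem_weightLE {N R : Matrix ι ι (AddMonoidAlgebra ℂ G)}
    (hN : ∀ i j, N i j ∈ weightLE φ (b + ψ i - ψ j))
    (hR : ∀ i j, R i j ∈ weightLE φ (b + ψ i - ψ j - 1)) :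
    (N + R).det - N.det ∈ weightLE φ (Fintype.card ι * b - 1) := by
  rw [Matrix.det_apply, Matrix.det_apply, ← Finset.sum_sub_distrib]
  refine sum_mem fun σ _ => ?_
  rw [← smul_sub, Units.smul_def]
  refine zsmul_mem ?_ _
  rw [← sum_add_sub_perm (ψ := ψ) σ]
  exact prod_add_sub_prod_mem_weightLE _ (fun i _ => hN _ _) fun i _ => hR _ _

end weightLE

section shift

variable {d : ℕ} (q : Fin d → ℕ+)

/-- The lattice point of `ℤ^d` underlying a point of the fundamental domain. -/
def toLattice {q : Fin d → ℕ+} (n : ∀ j, Fin (q j : ℕ)) : Fin d → ℤ := fun j => ((n j : ℕ) : ℤ)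

/-- Reduction of a lattice point to the fundamental domain. -/
def latticeRem (m : Fin d → ℤ) : ∀ j, Fin (q j : ℕ) := fun j => fem (q j) (m j)

/-- The coordinates of the translate of the fundamental domain containing a lattice point. -/
def latticeQuot (m : Fin d → ℤ) : Fin d → ℤ := fun j => m j / ((q j : ℕ) : ℤ)

theorem coe_fem (p : ℕ+) (a : ℤ) : ((fem p a : ℕ) : ℤ) = a % ((p : ℕ) : ℤ) := by
  rw [fem]
  exact Int.toNat_of_nonneg (Int.emod_nonneg a (by exact_mod_cast p.ne_zero))

theorem latticeRem_toLattice (n : ∀ j, Fin (q j : ℕ)) : latticeRem q (toLattice n) = n := by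
  funext j
  apply Fin.ext
  have h := coe_fem (q j) ((n j : ℕ) : ℤ)
  rw [Int.emod_eq_of_lt (by omega) (by exact_mod_cast (n j).2)] at h
  exact_mod_cast h

theorem latticeQuot_toLattice (n : ∀ j, Fin (q j : ℕ)) : latticeQuot q (toLattice n) = 0 := by
  funext j
  exact Int.ediv_eq_zero_of_lt (by simp [toLattice]) (by simp [toLattice])

theorem toLattice_latticeRem_add (m : Fin d → ℤ) (j : Fin d) :
    toLattice (latticeRem q m) j + ((q j : ℕ) : ℤ) * latticeQuot q m j = m j := by
  change ((fem (q j) (m j) : ℕ) : ℤ) + _ = _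
  rw [coe_fem]
  exact Int.emod_add_mul_ediv _ _

theorem latticeRem_toLattice_latticeRem_add (m t : Fin d → ℤ) :
    latticeRem q (toLattice (latticeRem q m) + t) = latticeRem q (m + t) := by
  funext j
  apply Fin.ext
  have h1 := coe_fem (q j) ((toLattice (latticeRem q m) + t) j)
  have h2 := coe_fem (q j) ((m + t) j)
  have h3 : (toLattice (latticeRem q m) + t) j % ((q j : ℕ) : ℤ) = (m + t) j % ((q j : ℕ) : ℤ) := by
    rw [Pi.add_apply, Pi.add_apply, ← toLattice_latticeRem_add q m j, add_right_comm,
      Int.add_mul_emod_self_left]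
  rw [h3, ← h2] at h1
  exact_mod_cast h1

theorem latticeQuot_add_latticeQuot (m t : Fin d → ℤ) :
    latticeQuot q m + latticeQuot q (toLattice (latticeRem q m) + t) = latticeQuot q (m + t) := by
  funext j
  have hq : ((q j : ℕ) : ℤ) ≠ 0 := by exact_mod_cast (q j).ne_zero
  change _ + (toLattice (latticeRem q m) j + t j) / ((q j : ℕ) : ℤ) = (m j + t j) / ((q j : ℕ) : ℤ)
  rw [← toLattice_latticeRem_add q m j, add_right_comm, Int.add_mul_ediv_left _ _ hq, add_comm]

/-- The matrix of the translation `u ↦ u (· + s)` on functions obeying Floquet boundary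
conditions, with formal Floquet multipliers. -/
def shiftMatrix (s : Fin d → ℤ) : Matrix (∀ j, Fin (q j : ℕ)) (∀ j, Fin (q j : ℕ))
    (AddMonoidAlgebra ℂ (Fin d → ℤ)) :=
  fun n n' => if latticeRem q (toLattice n + s) = n' then
    AddMonoidAlgebra.single (latticeQuot q (toLattice n + s)) 1 else 0

theorem shiftMatrix_zero : shiftMatrix q 0 = 1 := by
  ext1 n n'
  rw [shiftMatrix, add_zero, latticeRem_toLattice, latticeQuot_toLattice, Matrix.one_apply]
  rfl

theorem shiftMatrix_add (s t : Fin d → ℤ) :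
    shiftMatrix q (s + t) = shiftMatrix q s * shiftMatrix q t := by
  ext1 n n'
  rw [Matrix.mul_apply, Finset.sum_eq_single (latticeRem q (toLattice n + s))]
  · simp only [shiftMatrix, latticeRem_toLattice_latticeRem_add, if_true, mul_ite, mul_zero,
      AddMonoidAlgebra.single_mul_single, latticeQuot_add_latticeQuot, one_mul, add_assoc]
  · intro m _ hm
    simp [shiftMatrix, hm.symm]
  · simp

/-- The matrix `D_V - λ I` with formal Floquet multipliers. -/
def floquetMatrix (V : (Fin d → ℤ) → ℂ) (lam : ℂ) :
    Matrix (∀ j, Fin (q j : ℕ)) (∀ j, Fin (q j : ℕ)) (AddMonoidAlgebra ℂ (Fin d → ℤ)) :=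
  Matrix.diagonal (fun n => AddMonoidAlgebra.single 0 (V (toLattice n) - lam)) -
    ∑ j, (shiftMatrix q (Pi.single j 1) + shiftMatrix q (Pi.single j (-1)))

theorem laurentEval_shiftMatrix (z : Fin d → ℂˣ) (s : Fin d → ℤ) (n n' : ∀ j, Fin (q j : ℕ)) :
    laurentEval z (shiftMatrix q s n n') =
      extendBC q (fun j => (z j : ℂ)) (Pi.single n' 1) (toLattice n + s) := by
  change _ = (∏ j, (z j : ℂ) ^ (latticeQuot q (toLattice n + s) j)) *
    (Pi.single n' 1 : (∀ j, Fin (q j : ℕ)) → ℂ) (latticeRem q (toLattice n + s))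
  rw [shiftMatrix, Pi.single_apply]
  split_ifs <;> simp

theorem scriptP_eq_laurentEval (V : (Fin d → ℤ) → ℂ) (z : Fin d → ℂˣ) (lam : ℂ) :
    scriptP q V (fun j => (z j : ℂ)) lam = laurentEval z (floquetMatrix q V lam).det := by
  rw [scriptP, AlgHom.map_det]
  congr 1
  ext n n'
  have hup : ∀ (j : Fin d) (c : ℤ), Function.update (toLattice n) j (toLattice n j + c) =
      toLattice n + Pi.single j c := by
    intro j c
    funext i
    rcases eq_or_ne i j with rfl | h
    · simp
    · simp [h]
  have hlap : discLap (extendBC q (fun j => (z j : ℂ)) (Pi.single n' 1)) (toLattice n) =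
      laurentEval z
        ((∑ j, (shiftMatrix q (Pi.single j 1) + shiftMatrix q (Pi.single j (-1)))) n n') := by
    rw [discLap, Matrix.sum_apply, map_sum]
    refine Finset.sum_congr rfl fun j _ => ?_
    rw [Matrix.add_apply, map_add, laurentEval_shiftMatrix, laurentEval_shiftMatrix, ← hup, ← hup]
    rfl
  rw [AlgHom.mapMatrix_apply, Matrix.map_apply, floquetMatrix, Matrix.sub_apply,
    Matrix.sub_apply, map_sub, ← hlap, Matrix.smul_apply, Matrix.one_apply, Matrix.diagonal_apply]
  change -discLap _ (toLattice n) + V (toLattice n) * _ - _ = _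
  split_ifs
  · simp; ring
  · simp

end shift

/-- Weight of translations, in the two-dimensional case: exponents `k` stand for the lattice
vectors `(q₀ k₀, q₁ k₁)`. -/
theorem shiftMatrix_mem_weightLE (q : Fin 2 → ℕ+) (α β : ℤ) {s : Fin 2 → ℤ} {b : ℤ}
    (hs : linForm α β s ≤ b) (n n' : ∀ j, Fin (q j : ℕ)) :
    shiftMatrix q s n n' ∈ weightLE (linForm (α * (q 0 : ℕ)) (β * (q 1 : ℕ)))
      (b + linForm α β (toLattice n) - linForm α β (toLattice n')) := by
  rw [shiftMatrix]
  split_ifs with h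
  · subst h
    apply single_mem_weightLE
    have h0 := toLattice_latticeRem_add q (toLattice n + s) 0
    have h1 := toLattice_latticeRem_add q (toLattice n + s) 1
    simp only [linForm_apply, Pi.add_apply] at *
    linear_combination hs + α * h0 + β * h1
  · exact zero_mem _

section sign

variable {d : ℕ} (q : Fin d → ℕ+)

theorem coe_finRotate_eq_mod (p : ℕ) (a : Fin p) : (finRotate p a : ℕ) = (a + 1) % p := by
  cases p with
  | zero => exact a.elim0
  | succ n => rw [finRotate_apply, Fin.val_add, Fin.val_one', Nat.add_mod_mod]

/-- The cyclic permutation of the fundamental domain in the direction of one basis vector. -/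
def latticeRotate (i : Fin d) : Equiv.Perm (∀ j, Fin (q j : ℕ)) :=
  (Equiv.piSplitAt i fun j => Fin (q j : ℕ)).symm.permCongr
    (Equiv.prodCongrLeft fun _ => finRotate (q i : ℕ))

theorem latticeRotate_apply (i : Fin d) (n : ∀ j, Fin (q j : ℕ)) :
    latticeRotate q i n = latticeRem q (toLattice n + Pi.single i 1) := by
  funext j
  apply Fin.ext
  have h := coe_fem (q j) ((toLattice n + Pi.single i 1 : Fin d → ℤ) j)
  rcases eq_or_ne j i with rfl | hj
  · have h2 := coe_finRotate_eq_mod _ (n j)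
    have h3 : latticeRotate q j n j = finRotate _ (n j) := by simp [latticeRotate, Equiv.piSplitAt]
    rw [h3, h2]
    rw [Pi.add_apply, Pi.single_eq_same] at h
    change _ = (((n j : ℕ) : ℤ) + 1) % ((q j : ℕ) : ℤ) at h
    change _ = (fem (q j) ((toLattice n + Pi.single j 1 : Fin d → ℤ) j) : ℕ)
    rw [Pi.add_apply, Pi.single_eq_same]
    exact_mod_cast h.symm
  · have h3 : latticeRotate q i n j = n j := by simp [latticeRotate, Equiv.piSplitAt, hj]
    rw [h3]
    rw [Pi.add_apply, Pi.single_eq_of_ne hj, add_zero] at h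
    have := congrFun (latticeRem_toLattice q n) j
    rw [← this]
    change _ = (fem (q j) ((toLattice n + Pi.single i 1 : Fin d → ℤ) j) : ℕ)
    change (fem (q j) (toLattice n j) : ℕ) = _
    rw [Pi.add_apply, Pi.single_eq_of_ne hj, add_zero]

theorem sign_latticeRotate (i : Fin d) : Equiv.Perm.sign (latticeRotate q i) =
    (-1) ^ (((q i : ℕ) - 1) * Fintype.card (∀ j : {j // j ≠ i}, Fin (q j : ℕ))) := by
  rw [latticeRotate, Equiv.Perm.sign_permCongr, Equiv.Perm.sign_prodCongrLeft, sign_finRotate,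
    Finset.prod_const, Finset.card_univ, pow_mul]

theorem laurentEval_one_det_neg_shiftMatrix_single (i : Fin d) :
    laurentEval 1 (-shiftMatrix q (Pi.single i 1)).det =
      (-1) ^ Fintype.card (∀ j : {j // j ≠ i}, Fin (q j : ℕ)) := by
  have hperm : (laurentEval 1).mapMatrix (shiftMatrix q (Pi.single i 1)) =
      (latticeRotate q i).permMatrix ℂ := by
    ext n n'
    rw [AlgHom.mapMatrix_apply, Matrix.map_apply, shiftMatrix, ← latticeRotate_apply,
      Equiv.Perm.permMatrix, PEquiv.toMatrix_apply, Equiv.toPEquiv_apply]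
    simp only [Option.mem_some_iff]
    split_ifs <;> simp
  have hcard : Fintype.card (∀ j, Fin (q j : ℕ)) =
      (q i : ℕ) * Fintype.card (∀ j : {j // j ≠ i}, Fin (q j : ℕ)) := by
    rw [Fintype.card_congr (Equiv.piSplitAt i fun j => Fin (q j : ℕ)), Fintype.card_prod,
      Fintype.card_fin]
  rw [Matrix.det_neg, map_mul, map_pow, map_neg, map_one, AlgHom.map_det, hperm,
    Matrix.det_permutation, sign_latticeRotate, hcard]
  push_cast
  rw [← pow_add, ← add_mul]
  obtain ⟨m, hm⟩ := Nat.exists_eq_add_of_lt (q i).pos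
  rw [hm, show 0 + m + 1 + (0 + m + 1 - 1) = 2 * m + 1 by omega, add_mul, one_mul, pow_add,
    mul_assoc, pow_mul]
  simp

theorem laurentEval_one_det_neg_shiftMatrix_single_neg (i : Fin d) :
    laurentEval 1 (-shiftMatrix q (Pi.single i (-1))).det =
      (-1) ^ Fintype.card (∀ j : {j // j ≠ i}, Fin (q j : ℕ)) := by
  have h : (-shiftMatrix q (Pi.single i 1)).det * (-shiftMatrix q (Pi.single i (-1))).det = 1 := by
    rw [← Matrix.det_mul, neg_mul_neg, ← shiftMatrix_add, ← Pi.single_add, add_neg_cancel,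
      Pi.single_zero, shiftMatrix_zero, Matrix.det_one]
  have h' := congrArg (laurentEval 1) h
  rw [map_mul, map_one, laurentEval_one_det_neg_shiftMatrix_single] at h'
  rcases neg_one_pow_eq_or ℂ (Fintype.card (∀ j : {j // j ≠ i}, Fin (q j : ℕ))) with e | e
  · rw [e] at h' ⊢
    linear_combination h'
  · rw [e] at h' ⊢
    linear_combination -h'

end sign

section planar

variable (q : Fin 2 → ℕ+)

theorem card_fundamentalDomain :
    Fintype.card (∀ j, Fin (q j : ℕ)) = (q 0 : ℕ) * (q 1 : ℕ) := by
  simp [Fintype.card_pi, Fin.prod_univ_two]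

theorem card_transversal_zero :
    Fintype.card (∀ j : {j : Fin 2 // j ≠ 0}, Fin (q j : ℕ)) = (q 1 : ℕ) := by
  have h := card_fundamentalDomain q
  rw [Fintype.card_congr (Equiv.piSplitAt 0 fun j => Fin (q j : ℕ)), Fintype.card_prod,
    Fintype.card_fin] at h
  exact Nat.eq_of_mul_eq_mul_left (q 0).pos h

theorem card_transversal_one :
    Fintype.card (∀ j : {j : Fin 2 // j ≠ 1}, Fin (q j : ℕ)) = (q 0 : ℕ) := by
  have h := card_fundamentalDomain q
  rw [Fintype.card_congr (Equiv.piSplitAt 1 fun j => Fin (q j : ℕ)), Fintype.card_prod,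
    Fintype.card_fin, mul_comm] at h
  exact Nat.eq_of_mul_eq_mul_right (q 1).pos h

theorem det_mem_weightLE_linForm {M : Matrix (∀ j, Fin (q j : ℕ)) (∀ j, Fin (q j : ℕ))
      (AddMonoidAlgebra ℂ (Fin 2 → ℤ))} {α β b : ℤ}
    (hM : ∀ n n', M n n' ∈ weightLE (linForm (α * (q 0 : ℕ)) (β * (q 1 : ℕ)))
      (b + linForm α β (toLattice n) - linForm α β (toLattice n'))) :
    M.det ∈ weightLE (linForm (α * (q 0 : ℕ)) (β * (q 1 : ℕ)))
      (((q 0 : ℕ) : ℤ) * ((q 1 : ℕ) : ℤ) * b) := by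
  have := det_mem_weightLE (ψ := fun n => linForm α β (toLattice n)) hM
  rwa [card_fundamentalDomain, Nat.cast_mul] at this

theorem det_neg_shiftMatrix_eq_single {s k : Fin 2 → ℤ}
    (h0 : ((q 0 : ℕ) : ℤ) * k 0 = ((q 0 : ℕ) : ℤ) * ((q 1 : ℕ) : ℤ) * s 0)
    (h1 : ((q 1 : ℕ) : ℤ) * k 1 = ((q 0 : ℕ) : ℤ) * ((q 1 : ℕ) : ℤ) * s 1) :
    (-shiftMatrix q s).det =
      AddMonoidAlgebra.single k (laurentEval 1 (-shiftMatrix q s).det) := by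
  have hmem : ∀ α β : ℤ, (-shiftMatrix q s).det ∈
      weightLE (linForm (α * (q 0 : ℕ)) (β * (q 1 : ℕ)))
        (((q 0 : ℕ) : ℤ) * ((q 1 : ℕ) : ℤ) * linForm α β s) := fun α β =>
    det_mem_weightLE_linForm q fun n n' =>
      neg_mem (shiftMatrix_mem_weightLE q α β le_rfl n n')
  have hsupp : (-shiftMatrix q s).det.coeff.support ⊆ {k} := by
    intro a ha
    have e1 := hmem 1 0 a ha
    have e2 := hmem (-1) 0 a ha
    have e3 := hmem 0 1 a ha
    have e4 := hmem 0 (-1) a ha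
    simp only [linForm_apply] at e1 e2 e3 e4
    have f0 : ((q 0 : ℕ) : ℤ) * a 0 = ((q 0 : ℕ) : ℤ) * k 0 := by linarith
    have f1 : ((q 1 : ℕ) : ℤ) * a 1 = ((q 1 : ℕ) : ℤ) * k 1 := by linarith
    have g0 := mul_left_cancel₀ (by exact_mod_cast (q 0).ne_zero) f0
    have g1 := mul_left_cancel₀ (by exact_mod_cast (q 1).ne_zero) f1
    rw [Finset.mem_singleton]
    ext i; fin_cases i <;> assumption
  obtain ⟨c, hc⟩ := Finsupp.support_subset_singleton'.1 hsupp
  have hsingle : (-shiftMatrix q s).det = AddMonoidAlgebra.single k c :=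
    AddMonoidAlgebra.coeff_injective hc
  rw [hsingle, laurentEval_single]
  simp

section floquet

variable (V : (Fin 2 → ℤ) → ℂ) (lam : ℂ)

theorem diagonal_mem_weightLE {ι : Type*} [DecidableEq ι] {φ : (Fin 2 → ℤ) →+ ℤ} (ψ : ι → ℤ)
    {b : ℤ} (hb : 0 ≤ b) (v : ι → ℂ) (i j : ι) :
    Matrix.diagonal (fun i => AddMonoidAlgebra.single (0 : Fin 2 → ℤ) (v i)) i j ∈
      weightLE φ (b + ψ i - ψ j) := by
  rw [Matrix.diagonal_apply]
  split_ifs with h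
  · subst h
    exact single_mem_weightLE (by simpa using hb) _
  · exact zero_mem _

theorem det_floquetMatrix_mem_weightLE {α β : ℤ} (hα : |α| ≤ 1) (hβ : |β| ≤ 1) :
    (floquetMatrix q V lam).det ∈ weightLE (linForm (α * (q 0 : ℕ)) (β * (q 1 : ℕ)))
      (((q 0 : ℕ) : ℤ) * ((q 1 : ℕ) : ℤ)) := by
  rw [← mul_one (((q 0 : ℕ) : ℤ) * ((q 1 : ℕ) : ℤ))]
  refine det_mem_weightLE_linForm q fun n n' => ?_
  rw [abs_le] at hα hβ
  rw [floquetMatrix, Fin.sum_univ_two]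
  refine sub_mem (diagonal_mem_weightLE (fun n => linForm α β (toLattice n)) zero_le_one _ n n')
    (add_mem (add_mem ?_ ?_) (add_mem ?_ ?_)) <;>
  refine shiftMatrix_mem_weightLE q α β ?_ n n' <;> simp <;> omega

theorem coeff_det_floquetMatrix {α β : ℤ} {s k : Fin 2 → ℤ}
    (h0 : ((q 0 : ℕ) : ℤ) * k 0 = ((q 0 : ℕ) : ℤ) * ((q 1 : ℕ) : ℤ) * s 0)
    (h1 : ((q 1 : ℕ) : ℤ) * k 1 = ((q 0 : ℕ) : ℤ) * ((q 1 : ℕ) : ℤ) * s 1)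
    (hs : linForm α β s = 1)
    (hR : ∀ n n', (floquetMatrix q V lam + shiftMatrix q s) n n' ∈
      weightLE (linForm (α * (q 0 : ℕ)) (β * (q 1 : ℕ)))
        (0 + linForm α β (toLattice n) - linForm α β (toLattice n'))) :
    (floquetMatrix q V lam).det.coeff k = laurentEval 1 (-shiftMatrix q s).det := by
  have hdiff := det_add_sub_det_mem_weightLE (ψ := fun n => linForm α β (toLattice n)) (b := 1)
    (φ := linForm (α * (q 0 : ℕ)) (β * (q 1 : ℕ)))
    (N := -shiftMatrix q s) (R := floquetMatrix q V lam + shiftMatrix q s)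
    (fun n n' => neg_mem (shiftMatrix_mem_weightLE q α β hs.le n n'))
    (fun n n' => weightLE_mono (le_of_eq (by ring)) (hR n n'))
  rw [neg_add_cancel_comm_assoc, card_fundamentalDomain] at hdiff
  have hk := coeff_eq_zero_of_mem_weightLE hdiff (a := k) (by
    rw [linForm_apply] at hs ⊢
    push_cast
    have : α * ((q 0 : ℕ) : ℤ) * k 0 + β * ((q 1 : ℕ) : ℤ) * k 1 =
        ((q 0 : ℕ) : ℤ) * ((q 1 : ℕ) : ℤ) := by
      linear_combination α * h0 + β * h1 + ((q 0 : ℕ) : ℤ) * ((q 1 : ℕ) : ℤ) * hs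
    omega)
  rw [AddMonoidAlgebra.coeff_sub, Finsupp.sub_apply, sub_eq_zero] at hk
  rw [hk, det_neg_shiftMatrix_eq_single q h0 h1]
  simp

theorem coeff_det_floquetMatrix_east :
    (floquetMatrix q V lam).det.coeff ![((q 1 : ℕ) : ℤ), 0] = (-1) ^ (q 1 : ℕ) := by
  have h := laurentEval_one_det_neg_shiftMatrix_single q 0
  rw [card_transversal_zero] at h
  rw [← h]
  refine coeff_det_floquetMatrix q V lam (α := 1) (β := 0) (by simp) (by simp) (by simp)
    fun n n' => ?_
  rw [floquetMatrix, Fin.sum_univ_two, add_assoc (shiftMatrix q (Pi.single 0 1)),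
    ← sub_sub, sub_add_eq_add_sub, sub_add_cancel]
  refine sub_mem (diagonal_mem_weightLE (fun n => linForm 1 0 (toLattice n)) le_rfl _ n n')
    (add_mem ?_ (add_mem ?_ ?_)) <;>
  refine shiftMatrix_mem_weightLE q _ _ ?_ n n' <;> simp

theorem coeff_det_floquetMatrix_west :
    (floquetMatrix q V lam).det.coeff ![-((q 1 : ℕ) : ℤ), 0] = (-1) ^ (q 1 : ℕ) := by
  have h := laurentEval_one_det_neg_shiftMatrix_single_neg q 0
  rw [card_transversal_zero] at h
  rw [← h]
  refine coeff_det_floquetMatrix q V lam (α := -1) (β := 0) (by simp) (by simp) (by simp)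
    fun n n' => ?_
  rw [floquetMatrix, Fin.sum_univ_two, add_comm (shiftMatrix q (Pi.single 0 1)),
    add_assoc (shiftMatrix q (Pi.single 0 (-1))), ← sub_sub, sub_add_eq_add_sub, sub_add_cancel]
  refine sub_mem (diagonal_mem_weightLE (fun n => linForm (-1) 0 (toLattice n)) le_rfl _ n n')
    (add_mem ?_ (add_mem ?_ ?_)) <;>
  refine shiftMatrix_mem_weightLE q _ _ ?_ n n' <;> simp

theorem coeff_det_floquetMatrix_north :
    (floquetMatrix q V lam).det.coeff ![0, ((q 0 : ℕ) : ℤ)] = (-1) ^ (q 0 : ℕ) := by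
  have h := laurentEval_one_det_neg_shiftMatrix_single q 1
  rw [card_transversal_one] at h
  rw [← h]
  refine coeff_det_floquetMatrix q V lam (α := 0) (β := 1) (by simp) (by simp [mul_comm]) (by simp)
    fun n n' => ?_
  rw [floquetMatrix, Fin.sum_univ_two, add_comm (_ + _), add_assoc (shiftMatrix q (Pi.single 1 1)),
    ← sub_sub, sub_add_eq_add_sub, sub_add_cancel]
  refine sub_mem (diagonal_mem_weightLE (fun n => linForm 0 1 (toLattice n)) le_rfl _ n n')
    (add_mem ?_ (add_mem ?_ ?_)) <;>
  refine shiftMatrix_mem_weightLE q _ _ ?_ n n' <;> simp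

theorem coeff_det_floquetMatrix_south :
    (floquetMatrix q V lam).det.coeff ![0, -((q 0 : ℕ) : ℤ)] = (-1) ^ (q 0 : ℕ) := by
  have h := laurentEval_one_det_neg_shiftMatrix_single_neg q 1
  rw [card_transversal_one] at h
  rw [← h]
  refine coeff_det_floquetMatrix q V lam (α := 0) (β := -1) (by simp) (by simp [mul_comm])
    (by simp) fun n n' => ?_
  rw [floquetMatrix, Fin.sum_univ_two, add_comm (_ + _), add_comm (shiftMatrix q (Pi.single 1 1)),
    add_assoc (shiftMatrix q (Pi.single 1 (-1))), ← sub_sub, sub_add_eq_add_sub, sub_add_cancel]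
  refine sub_mem (diagonal_mem_weightLE (fun n => linForm 0 (-1) (toLattice n)) le_rfl _ n n')
    (add_mem ?_ (add_mem ?_ ?_)) <;>
  refine shiftMatrix_mem_weightLE q _ _ ?_ n n' <;> simp

end floquet

end planar

section factor

variable (q : Fin 2 → ℕ+)

theorem floquetMatrix_zero_eq_mul : floquetMatrix q (fun _ => 0) 0 =
    -(shiftMatrix q (Pi.single 0 1) + shiftMatrix q (Pi.single 1 1)) *
      (shiftMatrix q 0 + shiftMatrix q ![-1, -1]) := by
  have e0 : (Pi.single 0 1 + ![-1, -1] : Fin 2 → ℤ) = Pi.single 1 (-1) := by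
    ext i; fin_cases i <;> simp
  have e1 : (Pi.single 1 1 + ![-1, -1] : Fin 2 → ℤ) = Pi.single 0 (-1) := by
    ext i; fin_cases i <;> simp
  rw [neg_mul, add_mul, mul_add, mul_add, ← shiftMatrix_add, ← shiftMatrix_add, ← shiftMatrix_add,
    ← shiftMatrix_add, e0, e1, add_zero, add_zero, floquetMatrix, Fin.sum_univ_two]
  simp only [sub_self, AddMonoidAlgebra.single_zero, Matrix.diagonal_zero, zero_sub, neg_inj]
  abel

theorem linForm_det_floquetMatrix_zero (hc : IsCoprime ((q 0 : ℕ) : ℤ) ((q 1 : ℕ) : ℤ))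
    {a : Fin 2 → ℤ} (ha : a ∈ (floquetMatrix q (fun _ => 0) 0).det.coeff.support) :
    linForm (q 0 : ℕ) (q 1 : ℕ) a = ((q 0 : ℕ) : ℤ) * (q 1 : ℕ) ∨
      linForm (q 0 : ℕ) (q 1 : ℕ) a = -(((q 0 : ℕ) : ℤ) * (q 1 : ℕ)) := by
  rw [floquetMatrix_zero_eq_mul, Matrix.det_mul] at ha
  obtain ⟨f, hf, h, hh, rfl⟩ := AddMonoidAlgebra.exists_add_of_mem_support_mul ha
  have hF : ∀ α β b : ℤ, α ≤ b → β ≤ b →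
      linForm (α * (q 0 : ℕ)) (β * (q 1 : ℕ)) f ≤ ((q 0 : ℕ) : ℤ) * (q 1 : ℕ) * b :=
    fun α β b hα hβ => det_mem_weightLE_linForm q (fun n n' => neg_mem (add_mem
      (shiftMatrix_mem_weightLE q α β (by simpa using hα) n n')
      (shiftMatrix_mem_weightLE q α β (by simpa using hβ) n n'))) f hf
  have hH : ∀ α β b : ℤ, 0 ≤ b → -α - β ≤ b →
      linForm (α * (q 0 : ℕ)) (β * (q 1 : ℕ)) h ≤ ((q 0 : ℕ) : ℤ) * (q 1 : ℕ) * b :=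
    fun α β b h0 hb => det_mem_weightLE_linForm q (fun n n' => add_mem
      (shiftMatrix_mem_weightLE q α β (by simpa using h0) n n')
      (shiftMatrix_mem_weightLE q α β (by simp; omega) n n')) h hh
  have f1 := hF 1 1 1 le_rfl le_rfl
  have f2 := hF (-1) (-1) (-1) le_rfl le_rfl
  have h1 := hH 1 (-1) 0 le_rfl (by norm_num)
  have h2 := hH (-1) 1 0 le_rfl (by norm_num)
  have h3 := hH 1 1 0 le_rfl (by norm_num)
  have h4 := hH (-1) (-1) 2 (by norm_num) (by norm_num)
  have hr : (0 : ℤ) < (q 1 : ℕ) := by exact_mod_cast (q 1).pos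
  have hp : (0 : ℤ) < (q 0 : ℕ) := by exact_mod_cast (q 0).pos
  have hQ := mul_pos hp hr
  simp only [linForm_apply] at f1 f2 h1 h2 h3 h4
  obtain ⟨k, hk, hk'⟩ := exists_eq_mul_of_linForm_eq (x := h 0) (y := -h 1) hr.ne' hc (by linarith)
  have hk1 : h 1 = (q 0 : ℕ) * k := by linarith
  simp only [linForm_apply, Pi.add_apply]
  rw [hk, hk1] at h3 h4 ⊢
  have hlo : -1 ≤ k := by
    by_contra hcon
    nlinarith [mul_le_mul_of_nonneg_left (show k ≤ -2 by omega) hQ.le]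
  have hhi : k ≤ 0 := by
    by_contra hcon
    nlinarith [mul_le_mul_of_nonneg_left (show 1 ≤ k by omega) hQ.le]
  obtain rfl | rfl : k = 0 ∨ k = -1 := by omega
  · left; linarith
  · right; linarith

variable (V : (Fin 2 → ℤ) → ℂ) (lam : ℂ)

theorem abs_linForm_det_floquetMatrix_le {a : Fin 2 → ℤ}
    (ha : a ∈ (floquetMatrix q V lam).det.coeff.support) :
    |linForm (q 0 : ℕ) (q 1 : ℕ) a| ≤ ((q 0 : ℕ) : ℤ) * (q 1 : ℕ) ∧
      |linForm (q 0 : ℕ) (-(q 1 : ℕ)) a| ≤ ((q 0 : ℕ) : ℤ) * (q 1 : ℕ) := by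
  have h1 := det_floquetMatrix_mem_weightLE q V lam (α := 1) (β := 1) (by simp) (by simp) a ha
  have h2 := det_floquetMatrix_mem_weightLE q V lam (α := -1) (β := -1) (by simp) (by simp) a ha
  have h3 := det_floquetMatrix_mem_weightLE q V lam (α := 1) (β := -1) (by simp) (by simp) a ha
  have h4 := det_floquetMatrix_mem_weightLE q V lam (α := -1) (β := 1) (by simp) (by simp) a ha
  simp only [linForm_apply, abs_le] at *
  refine ⟨⟨?_, ?_⟩, ?_, ?_⟩ <;> linarith

/-- The determinant is the sum of its vertex terms as soon as its exponents lie on two opposite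
edges of the rhombus. -/
theorem det_floquetMatrix_eq (hc : IsCoprime ((q 0 : ℕ) : ℤ) ((q 1 : ℕ) : ℤ))
    (h : ∀ a ∈ (floquetMatrix q V lam).det.coeff.support,
      linForm (q 0 : ℕ) (q 1 : ℕ) a = ((q 0 : ℕ) : ℤ) * (q 1 : ℕ) ∨
      linForm (q 0 : ℕ) (q 1 : ℕ) a = -(((q 0 : ℕ) : ℤ) * (q 1 : ℕ))) :
    (floquetMatrix q V lam).det =
      AddMonoidAlgebra.single ![((q 1 : ℕ) : ℤ), 0] ((-1) ^ (q 1 : ℕ)) +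
      AddMonoidAlgebra.single ![-((q 1 : ℕ) : ℤ), 0] ((-1) ^ (q 1 : ℕ)) +
      AddMonoidAlgebra.single ![0, ((q 0 : ℕ) : ℤ)] ((-1) ^ (q 0 : ℕ)) +
      AddMonoidAlgebra.single ![0, -((q 0 : ℕ) : ℤ)] ((-1) ^ (q 0 : ℕ)) := by
  have hr : (0 : ℤ) < (q 1 : ℕ) := by exact_mod_cast (q 1).pos
  have hp : (0 : ℤ) < (q 0 : ℕ) := by exact_mod_cast (q 0).pos
  have hE := coeff_det_floquetMatrix_east q V lam
  have hW := coeff_det_floquetMatrix_west q V lam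
  have hN := coeff_det_floquetMatrix_north q V lam
  have hS := coeff_det_floquetMatrix_south q V lam
  have hvert : ∀ a, (floquetMatrix q V lam).det.coeff a ≠ 0 →
      a = ![((q 1 : ℕ) : ℤ), 0] ∨ a = ![-((q 1 : ℕ) : ℤ), 0] ∨
      a = ![0, ((q 0 : ℕ) : ℤ)] ∨ a = ![0, -((q 0 : ℕ) : ℤ)] := fun a ha =>
    have ha' := Finsupp.mem_support_iff.2 ha
    eq_vertex_of_linForm_eq hp hr hc (h a ha') (abs_linForm_det_floquetMatrix_le q V lam ha').2
  generalize (floquetMatrix q V lam).det = P at *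
  generalize ((q 0 : ℕ) : ℤ) = p at *
  generalize ((q 1 : ℕ) : ℤ) = r at *
  have n1 : (![r, 0] : Fin 2 → ℤ) ≠ ![-r, 0] := fun e => by
    have := congrFun e 0; simp at this; omega
  have n2 : (![r, 0] : Fin 2 → ℤ) ≠ ![0, p] := fun e => by
    have := congrFun e 0; simp at this; omega
  have n3 : (![r, 0] : Fin 2 → ℤ) ≠ ![0, -p] := fun e => by
    have := congrFun e 0; simp at this; omega
  have n4 : (![-r, 0] : Fin 2 → ℤ) ≠ ![0, p] := fun e => by
    have := congrFun e 0; simp at this; omega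
  have n5 : (![-r, 0] : Fin 2 → ℤ) ≠ ![0, -p] := fun e => by
    have := congrFun e 0; simp at this; omega
  have n6 : (![0, p] : Fin 2 → ℤ) ≠ ![0, -p] := fun e => by
    have := congrFun e 1; simp at this; omega
  apply AddMonoidAlgebra.coeff_injective
  ext a
  simp only [AddMonoidAlgebra.coeff_add, AddMonoidAlgebra.coeff_single, Finsupp.add_apply]
  by_cases ha : P.coeff a = 0
  · rw [ha, Finsupp.single_eq_of_ne, Finsupp.single_eq_of_ne, Finsupp.single_eq_of_ne,
      Finsupp.single_eq_of_ne]
    · simp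
    all_goals
      rintro rfl
      simp only [hE, hW, hN, hS] at ha
      exact pow_ne_zero _ (neg_ne_zero.2 one_ne_zero) ha
  · rcases hvert a ha with rfl | rfl | rfl | rfl <;>
      simp only [hE, hW, hN, hS, Finsupp.single_eq_same, Finsupp.single_eq_of_ne n1,
        Finsupp.single_eq_of_ne n2, Finsupp.single_eq_of_ne n3, Finsupp.single_eq_of_ne n4,
        Finsupp.single_eq_of_ne n5, Finsupp.single_eq_of_ne n6, Finsupp.single_eq_of_ne n1.symm,
        Finsupp.single_eq_of_ne n2.symm, Finsupp.single_eq_of_ne n3.symm,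
        Finsupp.single_eq_of_ne n4.symm, Finsupp.single_eq_of_ne n5.symm,
        Finsupp.single_eq_of_ne n6.symm, add_zero, zero_add]

end factor

theorem support_nontrivial_of_not_isMonomial {d : ℕ} {f : (Fin d → ℂ) → ℂ}
    {c : (Fin d → ℤ) →₀ ℂ} (hc : ∀ z : Fin d → ℂ, (∀ j, z j ≠ 0) →
      f z = c.sum fun a C => C * ∏ j, z j ^ a j)
    (hc0 : c ≠ 0) (hf : ¬ IsMonomial f) : c.support.Nontrivial := by
  by_contra h
  rw [Finset.Nontrivial, Set.not_nontrivial_iff] at h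
  obtain ⟨a, ha⟩ := Finsupp.support_nonempty_iff.2 hc0
  have hsub : c.support ⊆ {a} := fun b hb => Finset.mem_singleton.2 (h hb ha)
  obtain ⟨C, rfl⟩ := Finsupp.support_subset_singleton'.1 hsub
  refine hf ⟨C, a, fun hC => hc0 (by simp [hC]), fun z hz => ?_⟩
  rw [hc z hz, Finsupp.sum_single_index (by simp)]

/-- Let `d = 2` and `V : ℤ² → ℂ` be `Γ`-periodic.  If the Laurent
polynomial `z ↦ 𝒫_V(z, [V])` is reducible, then
`𝒫_V(z, [V]) = (-1)^{q₂} z₁^{q₂} + (-1)^{q₂} z₁^{-q₂} + (-1)^{q₁} z₂^{q₁} + (-1)^{q₁} z₂^{-q₁}`,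
which equals `𝒫_0(z, 0)` for the zero potential. -/
theorem statement4 (q : Fin 2 → ℕ+)
    (hq : ∀ i j, i ≠ j → Nat.Coprime (q i) (q j))
    (V : (Fin 2 → ℤ) → ℂ) (hV : IsPeriodic q V)
    (hred : ¬ LaurentIrreducible (fun z => scriptP q V z (avgPot q V))) :
    ∀ z : Fin 2 → ℂ, (∀ j, z j ≠ 0) →
      scriptP q V z (avgPot q V)
        = (-1 : ℂ) ^ ((q 1 : ℕ)) * z 0 ^ (((q 1 : ℕ) : ℤ))
          + (-1 : ℂ) ^ ((q 1 : ℕ)) * z 0 ^ (-((q 1 : ℕ) : ℤ))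
          + (-1 : ℂ) ^ ((q 0 : ℕ)) * z 1 ^ (((q 0 : ℕ) : ℤ))
          + (-1 : ℂ) ^ ((q 0 : ℕ)) * z 1 ^ (-((q 0 : ℕ) : ℤ)) ∧
      scriptP q V z (avgPot q V) = scriptP q (fun _ => 0) z 0 := by
  have hc : IsCoprime ((q 0 : ℕ) : ℤ) ((q 1 : ℕ) : ℤ) :=
    Nat.isCoprime_iff_coprime.2 (hq 0 1 (by decide))
  have hr : (0 : ℤ) < (q 1 : ℕ) := by exact_mod_cast (q 1).pos
  have hp : (0 : ℤ) < (q 0 : ℕ) := by exact_mod_cast (q 0).pos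
  rw [LaurentIrreducible, not_not] at hred
  obtain ⟨f, g, ⟨c, hfc⟩, ⟨e, hge⟩, hf, hg, hfg⟩ := hred
  have hmul : (floquetMatrix q V (avgPot q V)).det =
      AddMonoidAlgebra.ofCoeff c * AddMonoidAlgebra.ofCoeff e := by
    rw [← sub_eq_zero]
    refine eq_zero_of_laurentEval_eq_zero fun z => ?_
    have hz : ∀ j, (z j : ℂ) ≠ 0 := fun j => (z j).ne_zero
    rw [map_sub, map_mul, ← scriptP_eq_laurentEval, laurentEval_apply, laurentEval_apply,
      AddMonoidAlgebra.coeff_ofCoeff, AddMonoidAlgebra.coeff_ofCoeff, ← hfc _ hz, ← hge _ hz,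
      sub_eq_zero]
    exact hfg _ hz
  have hE : ![((q 1 : ℕ) : ℤ), 0] ∈ (floquetMatrix q V (avgPot q V)).det.coeff.support := by
    rw [Finsupp.mem_support_iff, coeff_det_floquetMatrix_east]
    exact pow_ne_zero _ (by norm_num)
  have hN : ![0, ((q 0 : ℕ) : ℤ)] ∈ (floquetMatrix q V (avgPot q V)).det.coeff.support := by
    rw [Finsupp.mem_support_iff, coeff_det_floquetMatrix_north]
    exact pow_ne_zero _ (by norm_num)
  have hbd := fun a => abs_linForm_det_floquetMatrix_le q V (avgPot q V) (a := a)
  have hV4 := det_floquetMatrix_eq q V (avgPot q V) hc (by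
    rw [hmul] at hE hN hbd ⊢
    refine AddMonoidAlgebra.linForm_eq_or_eq_neg_of_mul hp hr hc (fun a ha => (hbd a ha).1)
      (fun a ha => (hbd a ha).2) hE hN
      (support_nontrivial_of_not_isMonomial hfc ?_ hf)
      (support_nontrivial_of_not_isMonomial hge ?_ hg)
    · rintro rfl
      simp at hE
    · rintro rfl
      simp at hE)
  have h04 := det_floquetMatrix_eq q (fun _ => 0) 0 hc
    fun a => linForm_det_floquetMatrix_zero q hc
  intro z hz
  have hev : ∀ (W : (Fin 2 → ℤ) → ℂ) (lam : ℂ), scriptP q W z lam =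
      laurentEval (fun j => Units.mk0 (z j) (hz j)) (floquetMatrix q W lam).det :=
    fun W lam => scriptP_eq_laurentEval q W (fun j => Units.mk0 (z j) (hz j)) lam
  rw [hev, hev, hV4, h04]
  exact ⟨by simp [Fin.prod_univ_two], rfl⟩

end
end

section
/- Let the Floquet variety be 𝓕_λ(V)={z∈(ℂ\{0})^d : 𝒫_V(z,λ)=0}. For d≥3 and any Γ-periodic V:ℤ^d→ℂ, the set 𝓕_λ(V) is an irreducible algebraic subset of (ℂ\{0})^d for every λ∈ℂ (it cannot be written as the union of two nonempty proper subsets each of which is the zero set in 𝓕_λ(V) of finitely many Laurent polynomials). For d=2, 𝓕_λ(V) is irreducible for every λ∈ℂ with λ≠[V]; moreover, if 𝓕_{[V]}(V) is reducible, it has exactly two irreducible components. -/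
noncomputable section

/-- The Floquet variety `𝓕_λ(V) = {z ∈ (ℂ∖{0})^d : 𝒫_V(z, λ) = 0}`. -/
def FloquetVariety {d : ℕ} (q : Fin d → ℕ+) (V : (Fin d → ℤ) → ℂ) (lam : ℂ) :
    Set (Fin d → ℂ) :=
  {z | (∀ j, z j ≠ 0) ∧ scriptP q V z lam = 0}

/-- An algebraic subset of `(ℂ∖{0})^d`: the common zero set of finitely many
Laurent polynomials. -/
def IsAlgSubset {d : ℕ} (S : Set (Fin d → ℂ)) : Prop :=
  ∃ (m : ℕ) (f : Fin m → ((Fin d → ℂ) → ℂ)),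
    (∀ i, IsLaurent (f i)) ∧
    S = {z | (∀ j, z j ≠ 0) ∧ ∀ i, f i z = 0}

/-- Irreducibility of an algebraic subset of `(ℂ∖{0})^d`: it is nonempty and cannot
be written as the union of two proper nonempty algebraic subsets of itself. -/
def AlgIrreducible {d : ℕ} (S : Set (Fin d → ℂ)) : Prop :=
  S.Nonempty ∧
    ∀ S₁ S₂ : Set (Fin d → ℂ), IsAlgSubset S₁ → IsAlgSubset S₂ →
      S₁ ⊆ S → S₂ ⊆ S → S = S₁ ∪ S₂ → S₁ = S ∨ S₂ = S

/-- An irreducible component of `S`: a maximal irreducible algebraic subset of `S`. -/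
def IsIrredComponent {d : ℕ} (S T : Set (Fin d → ℂ)) : Prop :=
  IsAlgSubset T ∧ AlgIrreducible T ∧ T ⊆ S ∧
    ∀ T' : Set (Fin d → ℂ), IsAlgSubset T' → AlgIrreducible T' → T' ⊆ S → T ⊆ T' → T = T'

namespace Floquet

open Finset
open Matrix (diagonal det)

/-- The fundamental domain `W`. -/
abbrev Cell {d : ℕ} (q : Fin d → ℕ+) : Type := ∀ j, Fin (q j : ℕ)

/-- The complex torus `(ℂ∖{0})^d`. -/
def torus (d : ℕ) : Set (Fin d → ℂ) := {z | ∀ j, z j ≠ 0}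

/-- The covering map `w ↦ (w₁^{q₁}, …, w_d^{q_d})` of the torus. -/
def cover {d : ℕ} (q : Fin d → ℕ+) (w : Fin d → ℂ) : Fin d → ℂ := fun j => w j ^ (q j : ℕ)

lemma rho_eq_pow (q : ℕ+) (m : ℕ) : rho q m = rho q 1 ^ m := by
  unfold rho
  rw [← Complex.exp_nat_mul]
  congr 1
  push_cast
  ring

lemma rho_isPrimitiveRoot (q : ℕ+) : IsPrimitiveRoot (rho q 1) q := by
  have h := Complex.isPrimitiveRoot_exp (q : ℕ) q.ne_zero
  unfold rho
  convert h using 2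
  simp

lemma rho_ne_zero (q : ℕ+) (m : ℕ) : rho q m ≠ 0 := Complex.exp_ne_zero _

lemma rho_pow_self (q : ℕ+) (m : ℕ) : rho q m ^ (q : ℕ) = 1 := by
  rw [rho_eq_pow, ← pow_mul, mul_comm, pow_mul, (rho_isPrimitiveRoot q).pow_eq_one, one_pow]

lemma rho_zero (q : ℕ+) : rho q 0 = 1 := by simp [rho_eq_pow q 0]

lemma rho_injective (q : ℕ+) {a b : Fin (q : ℕ)} (h : rho q a = rho q b) : a = b := by
  rw [rho_eq_pow, rho_eq_pow q b] at h
  exact Fin.ext ((rho_isPrimitiveRoot q).pow_inj a.2 b.2 h)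

lemma sum_pow_rho_div (q : ℕ+) (a b : Fin (q : ℕ)) :
    ∑ k : Fin (q : ℕ), (rho q b / rho q a) ^ (k : ℕ) = if a = b then ((q : ℕ) : ℂ) else 0 := by
  split_ifs with h
  · subst h
    simp [div_self (rho_ne_zero q _)]
  · rw [Fin.sum_univ_eq_sum_range (fun k => (rho q b / rho q a) ^ k)]
    have hne : rho q b / rho q a ≠ 1 := by
      intro h1
      exact h (rho_injective q ((div_eq_one_iff_eq (rho_ne_zero q _)).1 h1)).symm
    rw [geom_sum_eq hne, div_pow, rho_pow_self, rho_pow_self]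
    simp

variable {d : ℕ} (q : Fin d → ℕ+)

/-- The Bloch wave `n ↦ ∏ⱼ (ρ_{mⱼ} wⱼ)^{nⱼ}`. -/
def bloch (w : Fin d → ℂ) (m : Cell q) (n : Fin d → ℤ) : ℂ :=
  ∏ j, (rho (q j) (m j) * w j) ^ n j

variable {q}

lemma bloch_update {w : Fin d → ℂ} (hw : w ∈ torus d) (m : Cell q) (n : Fin d → ℤ) (j : Fin d)
    (k : ℤ) :
    bloch q w m (Function.update n j (n j + k)) =
      (rho (q j) (m j) * w j) ^ k * bloch q w m n := by
  have h0 : rho (q j) (m j) * w j ≠ 0 := mul_ne_zero (rho_ne_zero _ _) (hw j)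
  unfold bloch
  rw [← mul_prod_erase univ _ (mem_univ j), ← mul_prod_erase univ (fun i => _ ^ n i) (mem_univ j),
    Function.update_self, zpow_add₀ h0]
  have : ∀ i ∈ univ.erase j, (rho (q i) (m i) * w i) ^ (Function.update n j (n j + k) i)
      = (rho (q i) (m i) * w i) ^ n i := by
    intro i hi
    rw [Function.update_of_ne (ne_of_mem_erase hi)]
  rw [prod_congr rfl this]
  ring

lemma extendBC_bloch {w : Fin d → ℂ} (hw : w ∈ torus d) (m : Cell q) :
    extendBC q (cover q w) (fun n : Cell q => bloch q w m (fun j => ((n j : ℕ) : ℤ))) =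
      bloch q w m := by
  funext n
  unfold extendBC bloch
  rw [← prod_mul_distrib]
  refine prod_congr rfl fun j _ => ?_
  have h0 : rho (q j) (m j) * w j ≠ 0 := mul_ne_zero (rho_ne_zero _ _) (hw j)
  have hq : ((q j : ℕ) : ℤ) ≠ 0 := by exact_mod_cast (q j).ne_zero
  have h1 : cover q w j = (rho (q j) (m j) * w j) ^ ((q j : ℕ) : ℤ) := by
    rw [cover, zpow_natCast, mul_pow, rho_pow_self, one_mul]
  have h2 : (((fem (q j) (n j) : Fin (q j : ℕ)) : ℕ) : ℤ) = n j % ((q j : ℕ) : ℤ) := by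
    simp only [fem]
    exact Int.toNat_of_nonneg (Int.emod_nonneg _ hq)
  beta_reduce
  rw [h1, h2, ← zpow_mul, ← zpow_add₀ h0, Int.mul_ediv_add_emod]

lemma sum_discLap_extendBC (z : Fin d → ℂ) (u : Cell q → ℂ) (n : Fin d → ℤ) :
    ∑ n' : Cell q, discLap (extendBC q z (Pi.single n' 1)) n * u n' =
      discLap (extendBC q z u) n := by
  have key : ∀ k : Fin d → ℤ,
      ∑ n' : Cell q, extendBC q z (Pi.single n' 1) k * u n' = extendBC q z u k := by
    intro k
    unfold extendBC
    simp_rw [mul_assoc, ← mul_sum]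
    congr 1
    simp [Pi.single_apply]
  unfold discLap
  simp_rw [sum_mul, add_mul]
  rw [sum_comm]
  simp_rw [sum_add_distrib, key]

/-- Bloch waves as the columns of a matrix. -/
def blochMat (q : Fin d → ℕ+) (w : Fin d → ℂ) : Matrix (Cell q) (Cell q) ℂ :=
  fun n m => bloch q w m (fun j => ((n j : ℕ) : ℤ))

/-- The inverse of `blochMat`. -/
def blochInv (q : Fin d → ℕ+) (w : Fin d → ℂ) : Matrix (Cell q) (Cell q) ℂ :=
  fun m n => (1 / ((∏ j, (q j : ℕ) : ℕ) : ℂ)) * (bloch q w m (fun j => ((n j : ℕ) : ℤ)))⁻¹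

/-- The potential in the basis of Bloch waves. -/
def potMat (q : Fin d → ℕ+) (V : (Fin d → ℤ) → ℂ) : Matrix (Cell q) (Cell q) ℂ :=
  fun m m' => (1 / ((∏ j, (q j : ℕ) : ℕ) : ℂ)) * ∑ n : Cell q,
    V (fun j => ((n j : ℕ) : ℤ)) * ∏ j, (rho (q j) (m' j) / rho (q j) (m j)) ^ (n j : ℕ)

lemma blochMat_apply (w : Fin d → ℂ) (n m : Cell q) :
    blochMat q w n m = bloch q w m (fun j => ((n j : ℕ) : ℤ)) := rfl

lemma blochInv_apply (w : Fin d → ℂ) (m n : Cell q) :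
    blochInv q w m n = (1 / ((∏ j, (q j : ℕ) : ℕ) : ℂ)) *
      (bloch q w m (fun j => ((n j : ℕ) : ℤ)))⁻¹ := rfl

lemma potMat_apply (V : (Fin d → ℤ) → ℂ) (m m' : Cell q) :
    potMat q V m m' = (1 / ((∏ j, (q j : ℕ) : ℕ) : ℂ)) * ∑ n : Cell q,
      V (fun j => ((n j : ℕ) : ℤ)) * ∏ j, (rho (q j) (m' j) / rho (q j) (m j)) ^ (n j : ℕ) := rfl

lemma bloch_inv_mul {w : Fin d → ℂ} (hw : w ∈ torus d) (m m' n : Cell q) :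
    (bloch q w m (fun j => ((n j : ℕ) : ℤ)))⁻¹ * bloch q w m' (fun j => ((n j : ℕ) : ℤ)) =
      ∏ j, (rho (q j) (m' j) / rho (q j) (m j)) ^ (n j : ℕ) := by
  unfold bloch
  rw [← prod_inv_distrib, ← prod_mul_distrib]
  refine prod_congr rfl fun j _ => ?_
  have h0 := rho_ne_zero (q j) (m j)
  have h1 := hw j
  rw [zpow_natCast, zpow_natCast, ← inv_pow, ← mul_pow]
  congr 1
  field_simp

lemma card_ne_zero (q : Fin d → ℕ+) : ((∏ j, (q j : ℕ) : ℕ) : ℂ) ≠ 0 := by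
  exact_mod_cast Finset.prod_ne_zero_iff.2 fun j _ => (q j).ne_zero

lemma blochInv_mul_blochMat {w : Fin d → ℂ} (hw : w ∈ torus d) :
    blochInv q w * blochMat q w = 1 := by
  ext m m'
  rw [Matrix.mul_apply]
  simp_rw [blochInv_apply, blochMat_apply, mul_assoc, bloch_inv_mul hw, ← mul_sum]
  have h := Finset.prod_univ_sum (fun j : Fin d => (univ : Finset (Fin (q j : ℕ))))
    (fun j k => (rho (q j) (m' j) / rho (q j) (m j)) ^ (k : ℕ))
  rw [Fintype.piFinset_univ] at h
  rw [← h]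
  simp_rw [sum_pow_rho_div]
  rw [Matrix.one_apply]
  split_ifs with hm
  · subst hm
    have := card_ne_zero q
    push_cast at this ⊢
    simp only [if_true]
    field_simp
  · obtain ⟨j, hj⟩ := Function.ne_iff.1 hm
    rw [prod_eq_zero (f := fun j => if m j = m' j then ((q j : ℕ) : ℂ) else 0) (mem_univ j)
      (if_neg hj), mul_zero]

lemma blochInv_mul_diagonal_mul {w : Fin d → ℂ} (hw : w ∈ torus d) (V : (Fin d → ℤ) → ℂ) :
    blochInv q w * (diagonal (fun n : Cell q => V (fun j => ((n j : ℕ) : ℤ))) * blochMat q w) =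
      potMat q V := by
  ext m m'
  rw [Matrix.mul_apply]
  simp_rw [Matrix.diagonal_mul, blochInv_apply, blochMat_apply, potMat_apply, mul_sum]
  refine sum_congr rfl fun n _ => ?_
  rw [← bloch_inv_mul hw]
  ring

lemma potMat_diag (V : (Fin d → ℤ) → ℂ) (m : Cell q) : potMat q V m m = avgPot q V := by
  simp [potMat, avgPot, div_self (rho_ne_zero _ _)]

lemma DVmat_mul_blochMat {w : Fin d → ℂ} (hw : w ∈ torus d) (V : (Fin d → ℤ) → ℂ) :
    DVmat q V (cover q w) * blochMat q w = blochMat q w * (Amat q w + potMat q V) := by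
  have h1 : blochMat q w * blochInv q w = 1 := mul_eq_one_comm.1 (blochInv_mul_blochMat hw)
  rw [mul_add, ← blochInv_mul_diagonal_mul hw V, ← mul_assoc (blochMat q w), h1, one_mul]
  ext n m
  rw [Matrix.add_apply, Amat, Matrix.mul_diagonal, Matrix.diagonal_mul, Matrix.mul_apply]
  simp_rw [DVmat, add_mul, neg_mul, sum_add_distrib, sum_neg_distrib]
  rw [sum_discLap_extendBC (cover q w) (fun n' => blochMat q w n' m)]
  have h2 : (fun n' : Cell q => blochMat q w n' m) =
      fun n : Cell q => bloch q w m (fun j => ((n j : ℕ) : ℤ)) := rfl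
  rw [h2, extendBC_bloch hw]
  congr 1
  · unfold discLap
    simp_rw [sub_eq_add_neg, bloch_update hw, zpow_one, zpow_neg_one, ← add_mul, ← sum_mul]
    rw [blochMat_apply, ← neg_mul, mul_comm, sum_add_distrib]
  · simp

/-- The Floquet determinant in the basis of Bloch waves. -/
theorem scriptP_cover {w : Fin d → ℂ} (hw : w ∈ torus d) (V : (Fin d → ℤ) → ℂ) (lam : ℂ) :
    scriptP q V (cover q w) lam =
      det (Amat q w + (potMat q V - lam • (1 : Matrix (Cell q) (Cell q) ℂ))) := by
  have h1 := blochInv_mul_blochMat (q := q) hw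
  have hdet : det (blochMat q w) ≠ 0 := by
    intro h
    have := congrArg det h1
    rw [Matrix.det_mul, h, mul_zero, Matrix.det_one] at this
    exact zero_ne_one this
  refine mul_right_cancel₀ hdet ?_
  rw [scriptP, ← Matrix.det_mul, mul_comm, ← Matrix.det_mul, sub_mul, DVmat_mul_blochMat hw,
    ← add_sub_assoc,
    mul_sub]
  simp

end Floquet

namespace Floquet

open Finset MvPolynomial

section Torus

variable {d : ℕ}

lemma eq_of_eval_torus {p r : MvPolynomial (Fin d) ℂ}
    (h : ∀ z ∈ torus d, eval z p = eval z r) : p = r := by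
  refine MvPolynomial.funext_set (fun _ => {(0 : ℂ)}ᶜ)
    (fun _ => (Set.finite_singleton _).infinite_compl) fun z hz => h z fun j => ?_
  simpa using hz j trivial

lemma prod_ne_zero_of_mem {z : Fin d → ℂ} (hz : z ∈ torus d) : ∏ j, z j ≠ 0 :=
  Finset.prod_ne_zero_iff.2 fun j _ => hz j

/-- A polynomial without zeros on the torus. -/
def NonVanishing (p : MvPolynomial (Fin d) ℂ) : Prop := ∀ z ∈ torus d, eval z p ≠ 0

lemma NonVanishing.of_dvd {p r : MvPolynomial (Fin d) ℂ} (hr : NonVanishing r) (h : p ∣ r) :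
    NonVanishing p := by
  rintro z hz h0
  obtain ⟨k, rfl⟩ := h
  exact hr z hz (by rw [map_mul, h0, zero_mul])

lemma NonVanishing.mul {p r : MvPolynomial (Fin d) ℂ} (hp : NonVanishing p)
    (hr : NonVanishing r) : NonVanishing (p * r) := fun z hz => by
  rw [map_mul]
  exact mul_ne_zero (hp z hz) (hr z hz)

lemma nonVanishing_prod_X : NonVanishing (∏ j : Fin d, X j : MvPolynomial (Fin d) ℂ) := by
  intro z hz
  simpa [map_prod] using prod_ne_zero_of_mem hz

/-- The Nullstellensatz for hypersurfaces in the torus. -/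
lemma exists_dvd_pow_mul {p r : MvPolynomial (Fin d) ℂ}
    (h : ∀ z ∈ torus d, eval z p = 0 → eval z r = 0) :
    ∃ N : ℕ, p ∣ (r * ∏ j, X j) ^ N := by
  have h1 : r * ∏ j, X j ∈ (Ideal.span {p}).radical := by
    rw [← vanishingIdeal_zeroLocus_eq_radical (K := ℂ), mem_vanishingIdeal_iff]
    intro z hz
    have hz' : eval z p = 0 := by
      simpa [aeval_eq_eval] using (mem_zeroLocus_iff.1 hz) p (Ideal.mem_span_singleton_self p)
    rw [aeval_eq_eval, map_mul, map_prod]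
    by_cases hzt : z ∈ torus d
    · rw [h z hzt hz', zero_mul]
    · obtain ⟨j, hj⟩ : ∃ j, z j = 0 := by simpa [torus] using hzt
      rw [prod_eq_zero (mem_univ j) (by simpa using hj), mul_zero]
  obtain ⟨N, hN⟩ := h1
  exact ⟨N, Ideal.mem_span_singleton.1 hN⟩

lemma NonVanishing.exists_monomial {p : MvPolynomial (Fin d) ℂ} (hp : NonVanishing p) :
    ∃ a c, c ≠ 0 ∧ p = monomial a c := by
  obtain ⟨N, hN⟩ := exists_dvd_pow_mul (p := p) (r := 1) fun z hz h0 => absurd h0 (hp z hz)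
  have h1 : ((1 : MvPolynomial (Fin d) ℂ) * ∏ j, X j) ^ N =
      monomial (Finsupp.equivFunOnFinite.symm fun _ => N) 1 := by
    rw [one_mul, ← prod_pow, monomial_eq]
    simp [Finsupp.prod_fintype]
  rw [h1, dvd_monomial_one_iff_exists] at hN
  obtain ⟨a, c, -, hc, rfl⟩ := hN
  exact ⟨a, c, hc.ne_zero, rfl⟩

lemma exists_prime_dvd {P : MvPolynomial (Fin d) ℂ} (h0 : P ≠ 0) (hP : ¬ NonVanishing P) :
    ∃ p, Prime p ∧ p ∣ P ∧ ¬ NonVanishing p := by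
  induction P using UniqueFactorizationMonoid.induction_on_prime with
  | h₁ => exact absurd rfl h0
  | h₂ x hx =>
    refine absurd (fun z _ => ?_) hP
    exact (hx.map (eval z)).ne_zero
  | h₃ a p ha hp ih =>
    by_cases hpn : NonVanishing p
    · obtain ⟨r, hr, hra, hrn⟩ := ih ha fun han => hP (hpn.mul han)
      exact ⟨r, hr, hra.mul_left p, hrn⟩
    · exact ⟨p, hp, dvd_mul_right _ _, hpn⟩

/-- Functions on the torus which become polynomial after multiplication by a power of
`z₁ ⋯ z_d`. -/
def IsCleared (f : (Fin d → ℂ) → ℂ) : Prop :=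
  ∃ (N : ℕ) (p : MvPolynomial (Fin d) ℂ), ∀ z ∈ torus d, eval z p = (∏ j, z j) ^ N * f z

lemma IsCleared.exists_ge {f : (Fin d → ℂ) → ℂ} (hf : IsCleared f) (N₀ : ℕ) :
    ∃ (N : ℕ) (p : MvPolynomial (Fin d) ℂ), N₀ ≤ N ∧
      ∀ z ∈ torus d, eval z p = (∏ j, z j) ^ N * f z := by
  obtain ⟨N, p, hp⟩ := hf
  refine ⟨N₀ + N, (∏ j, X j) ^ N₀ * p, Nat.le_add_right _ _, fun z hz => ?_⟩
  rw [map_mul, hp z hz, map_pow, map_prod]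
  simp only [eval_X]
  ring

lemma isCleared_const (c : ℂ) : IsCleared fun _ : Fin d → ℂ => c :=
  ⟨0, C c, fun z _ => by simp⟩

lemma isCleared_apply (j : Fin d) : IsCleared fun z : Fin d → ℂ => z j :=
  ⟨0, X j, fun z _ => by simp⟩

lemma isCleared_inv_apply (j : Fin d) : IsCleared fun z : Fin d → ℂ => (z j)⁻¹ := by
  refine ⟨1, ∏ i ∈ univ.erase j, X i, fun z hz => ?_⟩
  rw [map_prod, pow_one, ← mul_prod_erase univ _ (mem_univ j)]
  have := hz j
  simp only [eval_X]
  field_simp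

lemma IsCleared.mul {f g : (Fin d → ℂ) → ℂ} (hf : IsCleared f) (hg : IsCleared g) :
    IsCleared fun z => f z * g z := by
  obtain ⟨N, p, hp⟩ := hf
  obtain ⟨M, r, hr⟩ := hg
  refine ⟨N + M, p * r, fun z hz => ?_⟩
  rw [map_mul, hp z hz, hr z hz]
  ring

lemma IsCleared.add {f g : (Fin d → ℂ) → ℂ} (hf : IsCleared f) (hg : IsCleared g) :
    IsCleared fun z => f z + g z := by
  obtain ⟨N, p, hp⟩ := hf
  obtain ⟨M, r, hr⟩ := hg
  refine ⟨N + M, (∏ j, X j) ^ M * p + (∏ j, X j) ^ N * r, fun z hz => ?_⟩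
  rw [map_add, map_mul, map_mul, hp z hz, hr z hz, map_pow, map_pow, map_prod]
  simp only [eval_X]
  ring

lemma isCleared_sum {ι : Type*} (s : Finset ι) {f : ι → (Fin d → ℂ) → ℂ}
    (hf : ∀ i ∈ s, IsCleared (f i)) : IsCleared fun z => ∑ i ∈ s, f i z := by
  classical
  induction s using Finset.induction_on with
  | empty => simpa using isCleared_const 0
  | insert a s ha ih =>
    simp_rw [sum_insert ha]
    exact (hf a (mem_insert_self _ _)).add (ih fun i hi => hf i (mem_insert_of_mem hi))

lemma isCleared_prod {ι : Type*} (s : Finset ι) {f : ι → (Fin d → ℂ) → ℂ}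
    (hf : ∀ i ∈ s, IsCleared (f i)) : IsCleared fun z => ∏ i ∈ s, f i z := by
  classical
  induction s using Finset.induction_on with
  | empty => simpa using isCleared_const 1
  | insert a s ha ih =>
    simp_rw [prod_insert ha]
    exact (hf a (mem_insert_self _ _)).mul (ih fun i hi => hf i (mem_insert_of_mem hi))

lemma IsCleared.pow {f : (Fin d → ℂ) → ℂ} (hf : IsCleared f) (n : ℕ) :
    IsCleared fun z => f z ^ n := by
  simpa using isCleared_prod (range n) (f := fun _ => f) fun _ _ => hf

lemma isCleared_zpow_apply (j : Fin d) (k : ℤ) : IsCleared fun z : Fin d → ℂ => z j ^ k := by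
  obtain ⟨n, rfl | rfl⟩ := k.eq_nat_or_neg
  · simpa using (isCleared_apply j).pow n
  · simpa [zpow_neg] using (isCleared_inv_apply j).pow n

lemma isCleared_det {ι : Type*} [Fintype ι] [DecidableEq ι] {M : (Fin d → ℂ) → Matrix ι ι ℂ}
    (hM : ∀ i k, IsCleared fun z => M z i k) : IsCleared fun z => (M z).det := by
  simp_rw [Matrix.det_apply']
  exact isCleared_sum _ fun σ _ => (isCleared_const _).mul (isCleared_prod _ fun i _ => hM _ _)

lemma isCleared_of_isLaurent {f : (Fin d → ℂ) → ℂ} (hf : IsLaurent f) : IsCleared f := by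
  obtain ⟨c, hc⟩ := hf
  have h : IsCleared fun z : Fin d → ℂ => ∑ a ∈ c.support, c a * ∏ j, z j ^ a j :=
    isCleared_sum _ fun a _ => (isCleared_const _).mul
      (isCleared_prod _ fun j _ => isCleared_zpow_apply j _)
  obtain ⟨N, p, hp⟩ := h
  exact ⟨N, p, fun z hz => by rw [hp z hz, hc z hz, Finsupp.sum]⟩

lemma isLaurent_eval (p : MvPolynomial (Fin d) ℂ) : IsLaurent fun z => eval z p := by
  induction p using MvPolynomial.induction_on' with
  | monomial a c =>
    refine ⟨Finsupp.single (fun j => (a j : ℤ)) c, fun z _ => ?_⟩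
    beta_reduce
    rw [Finsupp.sum_single_index (by simp), eval_monomial, Finsupp.prod_fintype _ _ (by simp)]
    simp
  | add p r hp hr =>
    obtain ⟨c, hc⟩ := hp
    obtain ⟨c', hc'⟩ := hr
    refine ⟨c + c', fun z hz => ?_⟩
    beta_reduce at hc hc' ⊢
    rw [map_add, hc z hz, hc' z hz, Finsupp.sum_add_index' (by simp) (by intros; ring)]

lemma exists_separating {S : Set (Fin d → ℂ)} (hS : IsAlgSubset S) {z : Fin d → ℂ}
    (hz : z ∈ torus d) (hzS : z ∉ S) :
    ∃ p : MvPolynomial (Fin d) ℂ, eval z p ≠ 0 ∧ ∀ x ∈ S, eval x p = 0 := by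
  obtain ⟨m, f, hf, rfl⟩ := hS
  obtain ⟨i, hi⟩ : ∃ i, f i z ≠ 0 := by
    by_contra! h
    exact hzS ⟨hz, h⟩
  obtain ⟨N, p, hp⟩ := isCleared_of_isLaurent (hf i)
  refine ⟨p, ?_, fun x hx => ?_⟩
  · rw [hp z hz]
    exact mul_ne_zero (pow_ne_zero _ (prod_ne_zero_of_mem hz)) hi
  · rw [hp x hx.1, hx.2 i, mul_zero]

/-- Irreducibility can be tested on pairs of polynomials. -/
lemma algIrreducible_of_mul {S : Set (Fin d → ℂ)} (hne : S.Nonempty) (hS : S ⊆ torus d)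
    (h : ∀ p r : MvPolynomial (Fin d) ℂ, (∀ z ∈ S, eval z p * eval z r = 0) →
      (∀ z ∈ S, eval z p = 0) ∨ ∀ z ∈ S, eval z r = 0) : AlgIrreducible S := by
  refine ⟨hne, fun S₁ S₂ h₁ h₂ hs₁ hs₂ hu => ?_⟩
  by_contra! hcon
  obtain ⟨z₁, hz₁, hn₁⟩ := Set.exists_of_ssubset (hs₁.ssubset_of_ne hcon.1)
  obtain ⟨z₂, hz₂, hn₂⟩ := Set.exists_of_ssubset (hs₂.ssubset_of_ne hcon.2)
  obtain ⟨p, hp, hp0⟩ := exists_separating h₁ (hS hz₁) hn₁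
  obtain ⟨r, hr, hr0⟩ := exists_separating h₂ (hS hz₂) hn₂
  rcases h p r fun z hz => by
    rcases hu ▸ hz with hz | hz
    · rw [hp0 z hz, zero_mul]
    · rw [hr0 z hz, mul_zero] with h | h
  · exact hp (h z₁ hz₁)
  · exact hr (h z₂ hz₂)

/-- A polynomial which factors only trivially on the torus defines an irreducible hypersurface. -/
theorem algIrreducible_of_factor {P : MvPolynomial (Fin d) ℂ} (h0 : P ≠ 0)
    (hP : ¬ NonVanishing P) (hfac : ∀ f g, P = f * g → NonVanishing f ∨ NonVanishing g) :
    AlgIrreducible {z | z ∈ torus d ∧ eval z P = 0} := by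
  obtain ⟨p, hp, ⟨g, rfl⟩, hpn⟩ := exists_prime_dvd h0 hP
  have hg : NonVanishing g := (hfac p g rfl).resolve_left hpn
  have hZ : ∀ z, z ∈ {z | z ∈ torus d ∧ eval z (p * g) = 0} ↔ z ∈ torus d ∧ eval z p = 0 := by
    refine fun z => and_congr_right fun hz => ?_
    rw [map_mul, mul_eq_zero, or_iff_left (hg z hz)]
  refine algIrreducible_of_mul ?_ (fun z hz => hz.1) fun a b hab => ?_
  · unfold NonVanishing at hpn
    push Not at hpn
    obtain ⟨z, hz, h⟩ := hpn
    exact ⟨z, (hZ z).2 ⟨hz, h⟩⟩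
  · obtain ⟨N, hN⟩ := exists_dvd_pow_mul (p := p) (r := a * b) fun z hz h => by
      rw [map_mul]
      exact hab z ((hZ z).2 ⟨hz, h⟩)
    have hvan : ∀ c, p ∣ c → ∀ z ∈ {z | z ∈ torus d ∧ eval z (p * g) = 0}, eval z c = 0 := by
      rintro c ⟨k, rfl⟩ z hz
      rw [map_mul, ((hZ z).1 hz).2, zero_mul]
    rcases hp.dvd_or_dvd (hp.dvd_of_dvd_pow hN) with h | h
    · exact (hp.dvd_or_dvd h).imp (hvan a) (hvan b)
    · exact absurd (nonVanishing_prod_X.of_dvd h) hpn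

end Torus

end Floquet

namespace Floquet

open Finset MvPolynomial Filter Topology
open Matrix (diagonal det)

section Initial

variable {d : ℕ}

/-- The weight of an exponent. -/
def wt (ω : Fin d → ℤ) (a : Fin d →₀ ℕ) : ℤ := ∑ j, (a j : ℤ) * ω j

/-- The action of the one-parameter subgroup `ε ↦ (ε ^ ω₁, …, ε ^ ω_d)` on the torus. -/
def scale (ω : Fin d → ℤ) (ε : ℂ) (w : Fin d → ℂ) : Fin d → ℂ := fun j => ε ^ ω j * w j

lemma scale_mem {ω : Fin d → ℤ} {ε : ℂ} (hε : ε ≠ 0) {w : Fin d → ℂ} (hw : w ∈ torus d) :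
    scale ω ε w ∈ torus d := fun j => mul_ne_zero (zpow_ne_zero _ hε) (hw j)

/-- `f₀` is the part of `f` of lowest weight, and `m` is its weight. -/
structure IsInitial (ω : Fin d → ℤ) (f f₀ : MvPolynomial (Fin d) ℂ) (m : ℤ) : Prop where
  ne_zero : f₀ ≠ 0
  le_wt : ∀ a ∈ f.support, m ≤ wt ω a
  coeff_eq : ∀ a, coeff a f₀ = if wt ω a = m then coeff a f else 0

lemma exists_isInitial (ω : Fin d → ℤ) {f : MvPolynomial (Fin d) ℂ} (hf : f ≠ 0) :
    ∃ f₀ m, IsInitial ω f f₀ m := by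
  obtain ⟨a, ha, hmin⟩ := exists_min_image f.support (wt ω) (support_nonempty.2 hf)
  have hcoeff : ∀ b, coeff b (weightedHomogeneousComponent ω (wt ω a) f) =
      if wt ω b = wt ω a then coeff b f else 0 := by
    intro b
    rw [coeff_weightedHomogeneousComponent]
    have : Finsupp.weight ω b = wt ω b := by
      rw [Finsupp.weight_apply, Finsupp.sum_fintype _ _ (by simp)]
      simp [wt]
    rw [this]
  refine ⟨weightedHomogeneousComponent ω (wt ω a) f, wt ω a, fun h => ?_, hmin, hcoeff⟩
  have := hcoeff a
  rw [h, if_pos rfl, coeff_zero] at this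
  exact mem_support_iff.1 ha this.symm

lemma prod_scale_pow {ω : Fin d → ℤ} {ε : ℂ} (hε : ε ≠ 0) (w : Fin d → ℂ) (a : Fin d → ℕ) :
    ∏ j, scale ω ε w j ^ a j = ε ^ (∑ j, (a j : ℤ) * ω j) * ∏ j, w j ^ a j := by
  have h : ∀ s : Finset (Fin d), ε ^ (∑ j ∈ s, (a j : ℤ) * ω j) =
      ∏ j ∈ s, ε ^ ((a j : ℤ) * ω j) := by
    intro s
    induction s using Finset.induction_on with
    | empty => simp
    | insert i s hi ih => rw [sum_insert hi, prod_insert hi, zpow_add₀ hε, ih]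
  rw [h, ← prod_mul_distrib]
  refine prod_congr rfl fun j _ => ?_
  rw [scale, mul_pow, mul_comm (a j : ℤ), zpow_mul, zpow_natCast]

lemma IsInitial.tendsto {ω : Fin d → ℤ} {f f₀ : MvPolynomial (Fin d) ℂ} {m : ℤ}
    (h : IsInitial ω f f₀ m) (w : Fin d → ℂ) :
    Tendsto (fun ε : ℂ => ε ^ (-m) * eval (scale ω ε w) f) (𝓝[≠] 0) (𝓝 (eval w f₀)) := by
  have hcont : Continuous fun ε : ℂ =>
      ∑ a ∈ f.support, coeff a f * (ε ^ (wt ω a - m).toNat * ∏ j, w j ^ a j) := by fun_prop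
  have h0 : ∑ a ∈ f.support, coeff a f * ((0 : ℂ) ^ (wt ω a - m).toNat * ∏ j, w j ^ a j) =
      eval w f₀ := by
    rw [eval_eq']
    have hsub : f₀.support ⊆ f.support := by
      intro a ha
      rw [mem_support_iff, h.coeff_eq] at ha
      rw [mem_support_iff]
      intro h'
      simp [h'] at ha
    rw [sum_subset hsub fun a _ ha => by rw [notMem_support_iff.1 ha, zero_mul]]
    refine sum_congr rfl fun a ha => ?_
    rw [h.coeff_eq]
    have hle := h.le_wt a ha
    split_ifs with hm
    · simp [hm]
    · rw [zero_pow (by omega)]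
      simp
  rw [← h0]
  refine (hcont.tendsto 0).mono_left nhdsWithin_le_nhds |>.congr' ?_
  filter_upwards [self_mem_nhdsWithin] with ε (hε : ε ≠ 0)
  rw [eval_eq', mul_sum]
  refine sum_congr rfl fun a ha => ?_
  have hle := h.le_wt a ha
  rw [prod_scale_pow hε, ← zpow_natCast, Int.toNat_of_nonneg (by omega), sub_eq_add_neg,
    zpow_add₀ hε, wt]
  ring

lemma eq_zero_of_tendsto {F : ℂ → ℂ} {a b : ℤ} {A B : ℂ} (hab : a < b)
    (hA : Tendsto (fun ε : ℂ => ε ^ (-a) * F ε) (𝓝[≠] 0) (𝓝 A))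
    (hB : Tendsto (fun ε : ℂ => ε ^ (-b) * F ε) (𝓝[≠] 0) (𝓝 B)) : A = 0 := by
  have h1 : Tendsto (fun ε : ℂ => ε ^ (b - a).toNat) (𝓝[≠] 0) (𝓝 0) := by
    have : Continuous fun ε : ℂ => ε ^ (b - a).toNat := by fun_prop
    have h := (this.tendsto 0).mono_left (nhdsWithin_le_nhds (s := {(0 : ℂ)}ᶜ))
    rwa [zero_pow (by omega)] at h
  have h2 := h1.mul hB
  rw [zero_mul] at h2
  refine tendsto_nhds_unique (hA.congr' ?_) h2
  filter_upwards [self_mem_nhdsWithin] with ε (hε : ε ≠ 0)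
  rw [← zpow_natCast, Int.toNat_of_nonneg (by omega), ← mul_assoc, ← zpow_add₀ hε]
  congr 2
  ring

variable (q : Fin d → ℕ+)

/-- The polynomial `f(w₁^{q₁}, …, w_d^{q_d})`. -/
def lift (f : MvPolynomial (Fin d) ℂ) : MvPolynomial (Fin d) ℂ :=
  bind₁ (fun j => X j ^ (q j : ℕ)) f

variable {q}

lemma eval_lift (f : MvPolynomial (Fin d) ℂ) (w : Fin d → ℂ) :
    eval w (lift q f) = eval (cover q w) f := by
  rw [lift, ← aeval_eq_eval, aeval_bind₁, aeval_eq_eval]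
  congr 2
  funext j
  simp [cover]

lemma cover_mem {w : Fin d → ℂ} (hw : w ∈ torus d) : cover q w ∈ torus d :=
  fun j => pow_ne_zero _ (hw j)

lemma exists_cover_eq {z : Fin d → ℂ} (hz : z ∈ torus d) : ∃ w ∈ torus d, cover q w = z := by
  choose w hw using fun j => IsAlgClosed.exists_pow_nat_eq (z j) (q j).pos
  refine ⟨w, fun j h => hz j ?_, funext hw⟩
  rw [← hw j, h, zero_pow (q j).ne_zero]

lemma lift_ne_zero {f : MvPolynomial (Fin d) ℂ} (hf : f ≠ 0) : lift q f ≠ 0 := by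
  intro h
  refine hf (eq_of_eval_torus fun z hz => ?_)
  obtain ⟨w, -, rfl⟩ := exists_cover_eq (q := q) hz
  rw [← eval_lift, h, map_zero, map_zero]

lemma nonVanishing_lift_iff {f : MvPolynomial (Fin d) ℂ} :
    NonVanishing (lift q f) ↔ NonVanishing f := by
  refine ⟨fun h z hz => ?_, fun h w hw => ?_⟩
  · obtain ⟨w, hw, rfl⟩ := exists_cover_eq (q := q) hz
    rw [← eval_lift]
    exact h w hw
  · rw [eval_lift]
    exact h _ (cover_mem hw)

/-- The action of the deck group of the covering on the torus. -/
def rotate (m : Cell q) (w : Fin d → ℂ) : Fin d → ℂ := fun j => rho (q j) (m j) * w j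

lemma rotate_mem (m : Cell q) {w : Fin d → ℂ} (hw : w ∈ torus d) : rotate m w ∈ torus d :=
  fun j => mul_ne_zero (rho_ne_zero _ _) (hw j)

lemma cover_rotate (m : Cell q) (w : Fin d → ℂ) : cover q (rotate m w) = cover q w := by
  funext j
  rw [cover, rotate, mul_pow, rho_pow_self, one_mul, cover]

lemma scale_rotate (ω : Fin d → ℤ) (ε : ℂ) (m : Cell q) (w : Fin d → ℂ) :
    scale ω ε (rotate m w) = rotate m (scale ω ε w) := by
  funext j
  simp only [scale, rotate]
  ring

lemma IsInitial.eval_rotate {ω : Fin d → ℤ} {f f₀ : MvPolynomial (Fin d) ℂ} {k : ℤ}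
    (h : IsInitial ω (lift q f) f₀ k) (m : Cell q) (w : Fin d → ℂ) :
    eval (rotate m w) f₀ = eval w f₀ := by
  refine tendsto_nhds_unique (h.tendsto (rotate m w)) ((h.tendsto w).congr fun ε => ?_)
  rw [scale_rotate, eval_lift, eval_lift, cover_rotate]

/-- The part of lowest weight of the Floquet determinant. -/
def leading (q : Fin d → ℕ+) (ω : Fin d → ℤ) (w : Fin d → ℂ) : ℂ :=
  ∏ m : Cell q, -(∑ j, if ω j = 0 then 0 else (rho (q j) (m j) * w j) ^ (-ω j))

/-- A weight all of whose components are `-1`, `0` or `1`. -/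
def IsUnitWeight (ω : Fin d → ℤ) : Prop := ∀ j, ω j = -1 ∨ ω j = 0 ∨ ω j = 1

lemma tendsto_symbol {k : ℤ} (hk : k = -1 ∨ k = 0 ∨ k = 1) (u : ℂ) :
    Tendsto (fun ε : ℂ => ε * (ε ^ k * u + (ε ^ k * u)⁻¹)) (𝓝[≠] 0)
      (𝓝 (if k = 0 then 0 else u ^ (-k))) := by
  have key : ∀ a b : ℂ, Tendsto (fun ε : ℂ => ε ^ 2 * a + b) (𝓝[≠] 0) (𝓝 b) := by
    intro a b
    have : Continuous fun ε : ℂ => ε ^ 2 * a + b := by fun_prop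
    simpa using (this.tendsto 0).mono_left (nhdsWithin_le_nhds (s := {(0 : ℂ)}ᶜ))
  rcases hk with rfl | rfl | rfl
  · have h := key u⁻¹ u
    simp only [neg_eq_zero, one_ne_zero, if_false, neg_neg, zpow_one]
    refine h.congr' ?_
    filter_upwards [self_mem_nhdsWithin] with ε (hε : ε ≠ 0)
    rw [zpow_neg_one, mul_inv, inv_inv]
    field_simp
    ring
  · have : Continuous fun ε : ℂ => ε * (u + u⁻¹) := by fun_prop
    simpa using (this.tendsto 0).mono_left (nhdsWithin_le_nhds (s := {(0 : ℂ)}ᶜ))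
  · have h := key u u⁻¹
    simp only [one_ne_zero, if_false, zpow_neg_one, zpow_one]
    refine h.congr' ?_
    filter_upwards [self_mem_nhdsWithin] with ε (hε : ε ≠ 0)
    rw [mul_inv]
    field_simp

lemma tendsto_det {ω : Fin d → ℤ} (hω : IsUnitWeight ω) (B : Matrix (Cell q) (Cell q) ℂ)
    (w : Fin d → ℂ) :
    Tendsto (fun ε : ℂ => ε ^ Fintype.card (Cell q) * det (Amat q (scale ω ε w) + B)) (𝓝[≠] 0)
      (𝓝 (leading q ω w)) := by
  have h1 : Tendsto (fun ε : ℂ => ε • (Amat q (scale ω ε w) + B)) (𝓝[≠] 0)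
      (𝓝 (diagonal fun m : Cell q =>
        -(∑ j, if ω j = 0 then 0 else (rho (q j) (m j) * w j) ^ (-ω j)))) := by
    have hA : Tendsto (fun ε : ℂ => diagonal fun m : Cell q =>
        -(∑ j, ε * (ε ^ ω j * (rho (q j) (m j) * w j) + (ε ^ ω j * (rho (q j) (m j) * w j))⁻¹)))
        (𝓝[≠] 0) (𝓝 (diagonal fun m : Cell q =>
        -(∑ j, if ω j = 0 then 0 else (rho (q j) (m j) * w j) ^ (-ω j)))) := by
      refine ((continuous_id.matrix_diagonal).tendsto _).comp (tendsto_pi_nhds.2 fun m => ?_)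
      exact (tendsto_finsetSum _ fun j _ => tendsto_symbol (hω j) _).neg
    have hB : Tendsto (fun ε : ℂ => ε • B) (𝓝[≠] 0) (𝓝 0) := by
      have : Continuous fun ε : ℂ => ε • B := by fun_prop
      simpa using (this.tendsto 0).mono_left (nhdsWithin_le_nhds (s := {(0 : ℂ)}ᶜ))
    have h := hA.add hB
    rw [add_zero] at h
    refine h.congr fun ε => ?_
    rw [smul_add, Amat, ← Matrix.diagonal_smul]
    congr 2
    funext m
    simp only [Pi.smul_apply, smul_eq_mul, scale, mul_neg, mul_sum]
    congr 1
    refine sum_congr rfl fun j _ => ?_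
    rw [mul_left_comm (rho _ _)]
  have h2 := ((Continuous.matrix_det continuous_id).tendsto _).comp h1
  simp only [id_eq, Matrix.det_diagonal] at h2
  refine h2.congr fun ε => ?_
  rw [Function.comp_apply, Matrix.det_smul]

/-- A nonzero weight has a leading part which does not vanish identically. -/
lemma exists_leading_ne_zero {ω : Fin d → ℤ} (hω : IsUnitWeight ω) {j₀ : Fin d}
    (hj₀ : ω j₀ ≠ 0) : ∃ w ∈ torus d, leading q ω w ≠ 0 := by
  have hd : ((d : ℂ) + 1) ≠ 0 := by exact_mod_cast Nat.succ_ne_zero d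
  refine ⟨fun j => if j = j₀ then ((d : ℂ) + 1) ^ (-ω j₀) else 1, fun j => ?_, ?_⟩
  · beta_reduce
    split_ifs
    · exact zpow_ne_zero _ hd
    · exact one_ne_zero
  refine Finset.prod_ne_zero_iff.2 fun m _ => neg_ne_zero.2 fun h => ?_
  have hnorm : ∀ j, ‖rho (q j) (m j)‖ = 1 := fun j =>
    Complex.norm_eq_one_of_pow_eq_one (rho_pow_self _ _) (q j).ne_zero
  rw [← add_sum_erase _ _ (mem_univ j₀)] at h
  beta_reduce at h
  rw [if_neg hj₀, if_pos rfl] at h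
  have h1 : ‖(rho (q j₀) (m j₀) * ((d : ℂ) + 1) ^ (-ω j₀)) ^ (-ω j₀)‖ = d + 1 := by
    rw [norm_zpow, norm_mul, hnorm, one_mul, norm_zpow, ← zpow_mul]
    have : -ω j₀ * -ω j₀ = 1 := by
      rcases hω j₀ with h | h | h
      · rw [h]; norm_num
      · exact absurd h hj₀
      · rw [h]; norm_num
    rw [this, zpow_one]
    exact_mod_cast Complex.norm_natCast (d + 1)
  rw [eq_neg_of_add_eq_zero_left h, norm_neg] at h1
  have h2 : ∀ j ∈ univ.erase j₀, ‖if ω j = 0 then 0 else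
      (rho (q j) (m j) * if j = j₀ then ((d : ℂ) + 1) ^ (-ω j₀) else 1) ^ (-ω j)‖ ≤ 1 := by
    intro j hj
    rw [if_neg (ne_of_mem_erase hj)]
    split_ifs
    · simp
    · rw [mul_one, norm_zpow, hnorm, one_zpow]
  have h3 := norm_sum_le_of_le _ h2
  rw [h1, sum_const, card_erase_of_mem (mem_univ _), card_univ, Fintype.card_fin, nsmul_eq_mul,
    mul_one] at h3
  have h4 : ((d - 1 : ℕ) : ℝ) ≤ d := by exact_mod_cast Nat.sub_le d 1
  linarith

/-- `f * g` is the Floquet determinant, up to a monomial and the covering map. -/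
structure IsFactorization (q : Fin d → ℕ+) (B : Matrix (Cell q) (Cell q) ℂ) (N : ℕ)
    (f g : MvPolynomial (Fin d) ℂ) : Prop where
  card_le : Fintype.card (Cell q) ≤ N
  eval_mul : ∀ w ∈ torus d, eval (cover q w) f * eval (cover q w) g =
    (∏ j, cover q w j) ^ N * det (Amat q w + B)

variable {B : Matrix (Cell q) (Cell q) ℂ} {N : ℕ} {f g : MvPolynomial (Fin d) ℂ}

lemma IsFactorization.symm (h : IsFactorization q B N f g) : IsFactorization q B N g f :=
  ⟨h.card_le, fun w hw => by rw [mul_comm, h.eval_mul w hw]⟩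

lemma prod_cover_scale {ω : Fin d → ℤ} {ε : ℂ} (hε : ε ≠ 0) (w : Fin d → ℂ) :
    ∏ j, cover q (scale ω ε w) j = ε ^ (∑ j, ((q j : ℕ) : ℤ) * ω j) * ∏ j, cover q w j :=
  prod_scale_pow hε w _

/-- Initial parts of the factors multiply to the initial part of the determinant. -/
lemma IsFactorization.initial (h : IsFactorization q B N f g) {ω : Fin d → ℤ}
    (hω : IsUnitWeight ω) {j₀ : Fin d} (hj₀ : ω j₀ ≠ 0) {f₀ g₀ : MvPolynomial (Fin d) ℂ} {m n : ℤ}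
    (hf : IsInitial ω (lift q f) f₀ m) (hg : IsInitial ω (lift q g) g₀ n) :
    m + n = N * (∑ j, ((q j : ℕ) : ℤ) * ω j) - Fintype.card (Cell q) ∧
      ∀ w ∈ torus d, eval w f₀ * eval w g₀ = (∏ j, cover q w j) ^ N * leading q ω w := by
  set K : ℤ := N * (∑ j, ((q j : ℕ) : ℤ) * ω j) - Fintype.card (Cell q) with hK
  let F : (Fin d → ℂ) → ℂ → ℂ := fun w ε =>
    eval (scale ω ε w) (lift q f) * eval (scale ω ε w) (lift q g)
  have h1 : ∀ w, Tendsto (fun ε : ℂ => ε ^ (-(m + n)) * F w ε) (𝓝[≠] 0)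
      (𝓝 (eval w f₀ * eval w g₀)) := by
    intro w
    refine ((hf.tendsto w).mul (hg.tendsto w)).congr' ?_
    filter_upwards [self_mem_nhdsWithin] with ε (hε : ε ≠ 0)
    rw [neg_add, zpow_add₀ hε]
    ring
  have h2 : ∀ w ∈ torus d, Tendsto (fun ε : ℂ => ε ^ (-K) * F w ε) (𝓝[≠] 0)
      (𝓝 ((∏ j, cover q w j) ^ N * leading q ω w)) := by
    intro w hw
    refine ((tendsto_det hω B w).const_mul _).congr' ?_
    filter_upwards [self_mem_nhdsWithin] with ε (hε : ε ≠ 0)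
    simp only [F]
    rw [eval_lift, eval_lift, h.eval_mul _ (scale_mem hε hw), prod_cover_scale hε, mul_pow,
      ← zpow_natCast (ε ^ _) N, ← zpow_mul, ← mul_assoc (ε ^ (-K)), ← mul_assoc (ε ^ (-K)),
      ← zpow_add₀ hε, hK]
    rw [show ∀ a b : ℤ, -((N : ℤ) * a - b) + a * N = b by intros; ring, zpow_natCast]
    ring
  have hmn : m + n = K := by
    rcases lt_trichotomy (m + n) K with hlt | heq | hgt
    · exfalso
      have : f₀ * g₀ = 0 := eq_of_eval_torus fun w hw => by
        rw [map_mul, map_zero]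
        exact eq_zero_of_tendsto hlt (h1 w) (h2 w hw)
      exact (mul_ne_zero hf.ne_zero hg.ne_zero) this
    · exact heq
    · exfalso
      obtain ⟨w, hw, hne⟩ := exists_leading_ne_zero (q := q) hω hj₀
      have := eq_zero_of_tendsto hgt (h2 w hw) (h1 w)
      exact mul_ne_zero (pow_ne_zero _ (prod_ne_zero_of_mem (cover_mem hw))) hne this
  refine ⟨hmn, fun w hw => tendsto_nhds_unique (h1 w) ?_⟩
  rw [hmn]
  exact h2 w hw

lemma IsFactorization.ne_zero (hd : 0 < d) (h : IsFactorization q B N f g) : f ≠ 0 := by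
  rintro rfl
  have hω : IsUnitWeight (fun _ : Fin d => (1 : ℤ)) := fun _ => Or.inr (Or.inr rfl)
  obtain ⟨w, hw, hne⟩ := exists_leading_ne_zero (q := q) hω (j₀ := ⟨0, hd⟩) one_ne_zero
  refine hne (tendsto_nhds_unique (tendsto_det hω B w) ?_)
  refine tendsto_const_nhds.congr' ?_
  filter_upwards [self_mem_nhdsWithin] with ε (hε : ε ≠ 0)
  have hw' := scale_mem (ω := fun _ : Fin d => (1 : ℤ)) hε hw
  have h1 := h.eval_mul _ hw'
  rw [map_zero, zero_mul, eq_comm, mul_eq_zero] at h1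
  rw [h1.resolve_left (pow_ne_zero _ (prod_ne_zero_of_mem (cover_mem hw'))), mul_zero]

end Initial

end Floquet

namespace Floquet

open Finset MvPolynomial

section LinearForms

variable {d : ℕ}

lemma Prime.dvd_of_vanish {p r : MvPolynomial (Fin d) ℂ} (hp : Prime p) (hpn : ¬ NonVanishing p)
    (h : ∀ z ∈ torus d, eval z p = 0 → eval z r = 0) : p ∣ r := by
  obtain ⟨N, hN⟩ := exists_dvd_pow_mul h
  exact (hp.dvd_or_dvd (hp.dvd_of_dvd_pow hN)).resolve_right
    fun h => hpn (nonVanishing_prod_X.of_dvd h)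

/-- A transitive family of pairwise coprime primes cannot be distributed among two factors. -/
lemma nonVanishing_of_mul_eq_prod {ι : Type*} [Fintype ι] [Nonempty ι]
    {l : ι → MvPolynomial (Fin d) ℂ} {F G A B : MvPolynomial (Fin d) ℂ}
    (hl : ∀ i, Prime (l i)) (hln : ∀ i, ¬ NonVanishing (l i))
    (hrel : ∀ i j, i ≠ j → IsRelPrime (l i) (l j)) (hA : NonVanishing A) (hB : NonVanishing B)
    (h : F * G * A = B * ∏ i, l i) (hF : ∀ i j, l i ∣ F → l j ∣ F)
    (hG : ∀ i j, l i ∣ G → l j ∣ G) : NonVanishing F ∨ NonVanishing G := by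
  obtain ⟨i₀⟩ := ‹Nonempty ι›
  have key : ∀ F G : MvPolynomial (Fin d) ℂ, F * G * A = B * ∏ i, l i → (∀ i, l i ∣ F) →
      NonVanishing G := by
    intro F G h hF
    obtain ⟨k, rfl⟩ : ∏ i, l i ∣ F :=
      Finset.prod_dvd_of_isRelPrime (fun i _ j _ hij => hrel i j hij) fun i _ => hF i
    have hne : ∏ i, l i ≠ 0 := Finset.prod_ne_zero_iff.2 fun i _ => (hl i).ne_zero
    have h' : (∏ i, l i) * (k * G * A) = (∏ i, l i) * B := by linear_combination h
    exact hB.of_dvd ⟨k * A, by rw [← mul_left_cancel₀ hne h']; ring⟩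
  have h0 : l i₀ ∣ F * G * A := h ▸ (dvd_prod_of_mem l (mem_univ i₀)).mul_left B
  rcases (hl i₀).dvd_or_dvd h0 with h0 | h0
  · rcases (hl i₀).dvd_or_dvd h0 with h0 | h0
    · exact Or.inr (key F G h fun i => hF _ _ h0)
    · exact Or.inl (key G F (by rw [mul_comm G, h]) fun i => hG _ _ h0)
  · exact absurd (hA.of_dvd h0) (hln i₀)

/-- The linear form with given coefficients. -/
def linearForm (c : Fin d → ℂ) : MvPolynomial (Fin d) ℂ :=
  sumSMulX (Finsupp.equivFunOnFinite.symm c)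

lemma eval_linearForm (c w : Fin d → ℂ) : eval w (linearForm c) = ∑ j, c j * w j := by
  rw [linearForm, sumSMulX, Finsupp.linearCombination_apply, Finsupp.sum_fintype _ _ (by simp)]
  simp [smul_eval]

lemma coeff_linearForm (c : Fin d → ℂ) (j : Fin d) :
    coeff (Finsupp.single j 1) (linearForm c) = c j := by
  rw [linearForm, coeff_sumSMulX, Finsupp.equivFunOnFinite_symm_apply_apply]

lemma prime_linearForm {c : Fin d → ℂ} {j : Fin d} (hj : c j ≠ 0) : Prime (linearForm c) := by
  refine Irreducible.prime (irreducible_sumSMulX _ ⟨j, by simpa using hj⟩ fun r hr => ?_)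
  have := hr j
  rw [isUnit_iff_ne_zero]
  rintro rfl
  exact hj (zero_dvd_iff.1 this)

lemma not_nonVanishing_linearForm {c : Fin d → ℂ} {i j : Fin d} (hij : i ≠ j) (hi : c i ≠ 0)
    (hj : c j ≠ 0) : ¬ NonVanishing (linearForm c) := by
  intro h
  obtain ⟨a, k, -, hk⟩ := h.exists_monomial
  have h1 : ∀ i, c i ≠ 0 → a = Finsupp.single i 1 := by
    intro i hi
    rw [← coeff_linearForm c, hk, coeff_monomial] at hi
    by_contra h
    exact hi (if_neg h)
  have := (h1 i hi).symm.trans (h1 j hj)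
  exact hij (Finsupp.single_left_injective one_ne_zero this)

lemma isRelPrime_linearForm {c c' : Fin d → ℂ} (hc : Prime (linearForm c))
    (hc' : Prime (linearForm c')) (h : ∀ u : ℂ, ∃ j, c j * u ≠ c' j) :
    IsRelPrime (linearForm c) (linearForm c') := by
  rw [hc.irreducible.isRelPrime_iff_not_dvd]
  intro hdvd
  obtain ⟨u, hu⟩ := hc.irreducible.associated_of_dvd hc'.irreducible hdvd
  obtain ⟨r, -, hr⟩ := isUnit_iff_eq_C_of_isReduced.1 u.isUnit
  obtain ⟨j, hj⟩ := h r
  apply hj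
  rw [← coeff_linearForm c', ← hu, hr, mul_comm (linearForm c), coeff_C_mul, coeff_linearForm, mul_comm]

end LinearForms

section SignVectors

variable {d : ℕ} {q : Fin d → ℕ+}

/-- A weight all of whose components are `±1`. -/
def IsSign (s : Fin d → ℤ) : Prop := ∀ j, s j = 1 ∨ s j = -1

lemma IsSign.isUnitWeight {s : Fin d → ℤ} (hs : IsSign s) : IsUnitWeight s := fun j =>
  (hs j).elim (fun h => Or.inr (Or.inr h)) Or.inl

lemma IsSign.ne_zero {s : Fin d → ℤ} (hs : IsSign s) (j : Fin d) : s j ≠ 0 := by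
  rcases hs j with h | h <;> rw [h] <;> norm_num

lemma IsSign.mul_self {s : Fin d → ℤ} (hs : IsSign s) (j : Fin d) : s j * s j = 1 := by
  rcases hs j with h | h <;> rw [h] <;> norm_num

/-- The monomial automorphism of the torus attached to `-s`. -/
def flip (s : Fin d → ℤ) (u : Fin d → ℂ) : Fin d → ℂ := fun j => u j ^ (-s j)

lemma flip_mem {s : Fin d → ℤ} {u : Fin d → ℂ} (hu : u ∈ torus d) : flip s u ∈ torus d :=
  fun j => zpow_ne_zero _ (hu j)

lemma IsSign.flip_flip {s : Fin d → ℤ} (hs : IsSign s) (u : Fin d → ℂ) :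
    flip s (flip s u) = u := by
  funext j
  rw [flip, flip, ← zpow_mul, neg_mul_neg, hs.mul_self, zpow_one]

lemma isCleared_eval_flip (s : Fin d → ℤ) (F : MvPolynomial (Fin d) ℂ) :
    IsCleared fun u => eval (flip s u) F := by
  simp_rw [eval_eq']
  exact isCleared_sum _ fun a _ => (isCleared_const _).mul
    (isCleared_prod _ fun j _ => (isCleared_zpow_apply j _).pow _)

/-- The linear forms whose product is the leading part, in the coordinates given by `flip`. -/
def factorForm (s : Fin d → ℤ) (m : Cell q) : MvPolynomial (Fin d) ℂ :=
  linearForm fun j => -rho (q j) (m j) ^ (-s j)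

lemma eval_factorForm (s : Fin d → ℤ) (m : Cell q) (u : Fin d → ℂ) :
    eval u (factorForm s m) = -∑ j, rho (q j) (m j) ^ (-s j) * u j := by
  rw [factorForm, eval_linearForm, ← sum_neg_distrib]
  exact sum_congr rfl fun j _ => by ring

lemma IsSign.leading_flip {s : Fin d → ℤ} (hs : IsSign s) (u : Fin d → ℂ) :
    leading q s (flip s u) = ∏ m : Cell q, eval u (factorForm s m) := by
  refine prod_congr rfl fun m _ => ?_
  rw [eval_factorForm]
  congr 1
  refine sum_congr rfl fun j _ => ?_
  rw [if_neg (hs.ne_zero j), mul_zpow]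
  congr 1
  exact congrFun (hs.flip_flip u) j

lemma zpow_neg_ne_zero (s : Fin d → ℤ) (m : Cell q) (j : Fin d) :
    -rho (q j) (m j) ^ (-s j) ≠ 0 := neg_ne_zero.2 (zpow_ne_zero _ (rho_ne_zero _ _))

lemma prime_factorForm (hd : 2 ≤ d) (s : Fin d → ℤ) (m : Cell q) : Prime (factorForm s m) :=
  prime_linearForm (zpow_neg_ne_zero s m ⟨0, by omega⟩)

lemma not_nonVanishing_factorForm (hd : 2 ≤ d) (s : Fin d → ℤ) (m : Cell q) :
    ¬ NonVanishing (factorForm s m) :=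
  not_nonVanishing_linearForm (i := ⟨0, by omega⟩) (j := ⟨1, by omega⟩) (by simp)
    (zpow_neg_ne_zero s m _) (zpow_neg_ne_zero s m _)

lemma IsSign.isRelPrime_factorForm (hd : 2 ≤ d) (hq : ∀ i j, i ≠ j → Nat.Coprime (q i) (q j))
    {s : Fin d → ℤ} (hs : IsSign s) {m m' : Cell q} (hm : m ≠ m') :
    IsRelPrime (factorForm s m) (factorForm s m') := by
  refine isRelPrime_linearForm (prime_factorForm hd s m) (prime_factorForm hd s m') ?_
  by_contra! h
  obtain ⟨u, hu⟩ := h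
  have hone : ∀ (m : Cell q) j, (rho (q j) (m j) ^ (-s j)) ^ (q j : ℕ) = 1 := by
    intro m j
    rw [← zpow_natCast, ← zpow_mul, mul_comm, zpow_mul, zpow_natCast, rho_pow_self, one_zpow]
  have hu' : ∀ j, rho (q j) (m j) ^ (-s j) * u = rho (q j) (m' j) ^ (-s j) := fun j => by
    linear_combination -hu j
  have hpow : ∀ j, u ^ (q j : ℕ) = 1 := by
    intro j
    have := congrArg (· ^ (q j : ℕ)) (hu' j)
    simpa only [mul_pow, hone, one_mul] using this
  have hu1 : u = 1 := by
    rw [← orderOf_eq_one_iff]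
    have h0 := hq ⟨0, by omega⟩ ⟨1, by omega⟩ (by simp)
    exact Nat.eq_one_of_dvd_coprimes h0 (orderOf_dvd_of_pow_eq_one (hpow _))
      (orderOf_dvd_of_pow_eq_one (hpow _))
  refine hm (funext fun j => rho_injective (q j) ?_)
  have h1 := hu' j
  rw [hu1, mul_one] at h1
  have h2 := congrArg (· ^ (-s j)) h1
  simpa only [← zpow_mul, neg_mul_neg, hs.mul_self, zpow_one] using h2

lemma factorForm_dvd_of_dvd (hd : 2 ≤ d) {s : Fin d → ℤ} (hs : IsSign s)
    {F F' : MvPolynomial (Fin d) ℂ} (hF : ∀ (m : Cell q) w, eval (rotate m w) F = eval w F) {N : ℕ}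
    (hF' : ∀ u ∈ torus d, eval u F' = (∏ j, u j) ^ N * eval (flip s u) F) (m m' : Cell q)
    (h : factorForm s m ∣ F') : factorForm s m' ∣ F' := by
  refine Prime.dvd_of_vanish (prime_factorForm hd s m') (not_nonVanishing_factorForm hd s m')
    fun u hu h0 => ?_
  have hzero : ∀ u ∈ torus d, eval u F' = 0 ↔ eval (flip s u) F = 0 := by
    intro u hu
    rw [hF' u hu, mul_eq_zero, or_iff_right (pow_ne_zero _ (prod_ne_zero_of_mem hu))]
  rw [hzero u hu]
  let v : Fin d → ℂ := fun j =>
    rho (q j) (m j) ^ (s j) * (rho (q j) (m' j) ^ (-s j) * u j)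
  have hv : v ∈ torus d := fun j => mul_ne_zero (zpow_ne_zero _ (rho_ne_zero _ _))
    (mul_ne_zero (zpow_ne_zero _ (rho_ne_zero _ _)) (hu j))
  have hv0 : eval v (factorForm s m) = 0 := by
    rw [← h0, eval_factorForm, eval_factorForm]
    congr 1
    refine sum_congr rfl fun j _ => ?_
    simp only [v]
    rw [← mul_assoc, ← zpow_add₀ (rho_ne_zero _ _), neg_add_cancel, zpow_zero, one_mul]
  obtain ⟨k, rfl⟩ := h
  have h1 := (hzero v hv).1 (by rw [map_mul, hv0, zero_mul])
  rw [← hF m] at h1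
  rw [← hF m']
  convert h1 using 3
  funext j
  simp only [rotate, flip, v]
  rw [mul_zpow, mul_zpow, ← zpow_mul, ← zpow_mul, neg_mul_neg, hs.mul_self, zpow_one, mul_neg,
    hs.mul_self, zpow_neg_one, mul_inv_cancel_left₀ (rho_ne_zero _ _)]

/-- The leading part for a sign vector has no nontrivial invariant factorization. -/
theorem IsSign.nonVanishing_or (hd : 2 ≤ d) (hq : ∀ i j, i ≠ j → Nat.Coprime (q i) (q j))
    {s : Fin d → ℤ} (hs : IsSign s) {N : ℕ} {F G : MvPolynomial (Fin d) ℂ}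
    (hF : ∀ (m : Cell q) w, eval (rotate m w) F = eval w F)
    (hG : ∀ (m : Cell q) w, eval (rotate m w) G = eval w G)
    (h : ∀ w ∈ torus d, eval w F * eval w G = (∏ j, cover q w j) ^ N * leading q s w) :
    NonVanishing F ∨ NonVanishing G := by
  obtain ⟨N₁, F', hF'⟩ := isCleared_eval_flip s F
  obtain ⟨N₂, G', hG'⟩ := isCleared_eval_flip s G
  obtain ⟨N₃, A, hA⟩ := isCleared_eval_flip s ((∏ j, X j ^ (q j : ℕ)) ^ N)
  have hAn : ∀ u ∈ torus d, eval u A = (∏ j, u j) ^ N₃ * (∏ j, cover q (flip s u) j) ^ N := by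
    intro u hu
    rw [hA u hu]
    simp [cover]
  have hunit : ∀ (n : ℕ), NonVanishing ((∏ j : Fin d, X j : MvPolynomial (Fin d) ℂ) ^ n) := by
    intro n u hu
    rw [map_pow]
    exact pow_ne_zero _ (nonVanishing_prod_X u hu)
  have back : ∀ {F F' : MvPolynomial (Fin d) ℂ} {N : ℕ},
      (∀ u ∈ torus d, eval u F' = (∏ j, u j) ^ N * eval (flip s u) F) → NonVanishing F' →
      NonVanishing F := by
    intro F F' N hF' hn w hw h0
    have := hF' (flip s w) (flip_mem hw)
    rw [hs.flip_flip, h0, mul_zero] at this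
    exact hn _ (flip_mem hw) this
  refine (nonVanishing_of_mul_eq_prod (l := fun m : Cell q => factorForm s m)
    (F := F') (G := G') (A := (∏ j, X j) ^ N₃) (B := (∏ j, X j) ^ (N₁ + N₂) * A)
    (prime_factorForm hd s)
    (not_nonVanishing_factorForm hd s) (fun m m' => hs.isRelPrime_factorForm hd hq) (hunit _)
    ((hunit _).mul fun u hu => ?_) (eq_of_eval_torus fun u hu => ?_)
    (factorForm_dvd_of_dvd hd hs hF hF') (factorForm_dvd_of_dvd hd hs hG hG')).imp
    (back hF') (back hG')
  · rw [hAn u hu]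
    exact mul_ne_zero (pow_ne_zero _ (prod_ne_zero_of_mem hu))
      (pow_ne_zero _ (prod_ne_zero_of_mem (cover_mem (flip_mem hu))))
  · have h1 := h _ (flip_mem (s := s) hu)
    rw [hs.leading_flip] at h1
    simp only [map_mul, map_pow, map_prod, eval_X]
    rw [hF' u hu, hG' u hu, hAn u hu]
    linear_combination (∏ j, u j) ^ N₁ * (∏ j, u j) ^ N₂ * (∏ j, u j) ^ N₃ * h1

end SignVectors

end Floquet

namespace Floquet

open Finset MvPolynomial

section Corners

variable {d : ℕ} {q : Fin d → ℕ+} {B : Matrix (Cell q) (Cell q) ℂ} {N : ℕ}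
  {f g : MvPolynomial (Fin d) ℂ}

/-- A sign vector as a weight. -/
def sgn (s : Fin d → ℤˣ) : Fin d → ℤ := fun j => (s j : ℤ)

lemma isSign_sgn (s : Fin d → ℤˣ) : IsSign (sgn s) := fun j =>
  (Int.units_eq_one_or (s j)).imp (fun h => by simp [sgn, h]) fun h => by simp [sgn, h]

lemma wt_neg_sgn (s : Fin d → ℤˣ) (a : Fin d →₀ ℕ) : wt (sgn (-s)) a = -wt (sgn s) a := by
  simp [wt, sgn]

lemma IsInitial.mem_support {ω : Fin d → ℤ} {f f₀ : MvPolynomial (Fin d) ℂ} {m : ℤ}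
    (h : IsInitial ω f f₀ m) {a : Fin d →₀ ℕ} (ha : a ∈ f₀.support) : a ∈ f.support := by
  rw [mem_support_iff, h.coeff_eq] at ha
  rw [mem_support_iff]
  intro h'
  simp [h'] at ha

lemma IsInitial.mem_support_of_wt {ω : Fin d → ℤ} {f f₀ : MvPolynomial (Fin d) ℂ} {m : ℤ}
    (h : IsInitial ω f f₀ m) {a : Fin d →₀ ℕ} (ha : a ∈ f.support) (hm : wt ω a = m) :
    a ∈ f₀.support := by
  rwa [mem_support_iff, h.coeff_eq, if_pos hm, ← mem_support_iff]

lemma leading_single (j : Fin d) (σ : ℤˣ) :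
    ∃ c : ℂ, c ≠ 0 ∧ ∀ w, leading q (Pi.single j (σ : ℤ)) w =
      c * (w j ^ (-(σ : ℤ))) ^ Fintype.card (Cell q) := by
  refine ⟨∏ m : Cell q, -rho (q j) (m j) ^ (-(σ : ℤ)), Finset.prod_ne_zero_iff.2 fun m _ =>
    neg_ne_zero.2 (zpow_ne_zero _ (rho_ne_zero _ _)), fun w => ?_⟩
  rw [← card_univ, ← prod_const, ← prod_mul_distrib]
  refine prod_congr rfl fun m _ => ?_
  rw [sum_eq_single j]
  · rw [Pi.single_eq_same, if_neg σ.ne_zero, mul_zpow, neg_mul]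
  · intro i _ hi
    rw [Pi.single_eq_of_ne hi, if_pos rfl]
  · simp

/-- The extreme exponents of the Floquet determinant in the coordinate directions. -/
lemma IsFactorization.exists_corner (h : IsFactorization q B N f g) (j : Fin d) (σ : ℤˣ) :
    ∃ a ∈ (lift q f).support, ∃ b ∈ (lift q g).support, ∀ i,
      (a i : ℤ) + b i = N * (q i : ℕ) - if i = j then (σ : ℤ) * Fintype.card (Cell q) else 0 := by
  have hd : 0 < d := j.pos
  set Q := Fintype.card (Cell q) with hQ
  have hω : IsUnitWeight (Pi.single j (σ : ℤ)) := by
    intro i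
    by_cases hi : i = j
    · subst hi
      rw [Pi.single_eq_same]
      rcases Int.units_eq_one_or σ with rfl | rfl
      · exact Or.inr (Or.inr rfl)
      · exact Or.inl rfl
    · rw [Pi.single_eq_of_ne hi]
      exact Or.inr (Or.inl rfl)
  obtain ⟨f₀, m, hf⟩ := exists_isInitial (Pi.single j (σ : ℤ))
    (lift_ne_zero (q := q) (h.ne_zero hd))
  obtain ⟨g₀, n, hg⟩ := exists_isInitial (Pi.single j (σ : ℤ))
    (lift_ne_zero (q := q) (h.symm.ne_zero hd))
  have hprod := (h.initial hω (j₀ := j) (by rw [Pi.single_eq_same]; exact σ.ne_zero) hf hg).2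
  obtain ⟨c, hc, hlead⟩ := leading_single (q := q) j σ
  let γ : Fin d → ℤ := fun i => N * (q i : ℕ) - if i = j then (σ : ℤ) * Q else 0
  have hγ : ∀ i, 0 ≤ γ i := by
    intro i
    have h1 : (Q : ℤ) ≤ N * (q i : ℕ) := by
      exact_mod_cast h.card_le.trans (Nat.le_mul_of_pos_right _ (q i).pos)
    simp only [γ]
    split_ifs
    · rcases Int.units_eq_one_or σ with rfl | rfl <;> push_cast <;> omega
    · omega
  let a : Fin d →₀ ℕ := Finsupp.equivFunOnFinite.symm fun i => (γ i).toNat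
  have ha : ∀ i, (a i : ℤ) = γ i := fun i => by simp [a, Int.toNat_of_nonneg (hγ i)]
  have hmul : f₀ * g₀ = monomial a c := by
    refine eq_of_eval_torus fun w hw => ?_
    rw [map_mul, hprod w hw, hlead, eval_monomial, Finsupp.prod_fintype _ _ (by simp),
      mul_left_comm]
    congr 1
    have h1 : ∀ i, w i ^ a i = (w i ^ (q i : ℕ)) ^ N *
        if i = j then (w j ^ (-(σ : ℤ))) ^ Q else 1 := by
      intro i
      rw [← zpow_natCast (w i) (a i), ha]
      simp only [γ]
      rw [sub_eq_add_neg, zpow_add₀ (hw i), mul_comm (N : ℤ), zpow_mul, zpow_natCast, zpow_natCast]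
      split_ifs with hi
      · subst hi
        rw [← neg_mul, zpow_mul, zpow_natCast]
      · simp
    simp_rw [h1, prod_mul_distrib, prod_pow]
    rw [prod_ite_eq' univ j, if_pos (mem_univ _)]
    rfl
  have hmem : a ∈ (f₀ * g₀).support := by
    rw [hmul, mem_support_iff, coeff_monomial, if_pos rfl]
    exact hc
  obtain ⟨b, hb, b', hb', hsum⟩ := Finset.mem_add.1 (support_mul _ _ hmem)
  refine ⟨b, hf.mem_support hb, b', hg.mem_support hb', fun i => ?_⟩
  rw [← Nat.cast_add, ← Finsupp.add_apply, hsum, ha]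

/-- Exponents `α j σ` of `f` and `β j σ` of `g` adding up to the extreme exponents of the Floquet
determinant. -/
structure Corners (q : Fin d → ℕ+) (N : ℕ) (f g : MvPolynomial (Fin d) ℂ)
    (α β : Fin d → ℤˣ → Fin d →₀ ℕ) : Prop where
  add_eq : ∀ j σ i, (α j σ i : ℤ) + β j σ i =
    N * (q i : ℕ) - if i = j then (σ : ℤ) * Fintype.card (Cell q) else 0
  left_le : ∀ s j, ∀ a ∈ (lift q f).support, wt (sgn s) (α j (s j)) ≤ wt (sgn s) a
  right_le : ∀ s j, ∀ b ∈ (lift q g).support, wt (sgn s) (β j (s j)) ≤ wt (sgn s) b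
  eq_or_eq : ∀ s : Fin d → ℤˣ, (∀ j k, α j (s j) = α k (s k)) ∨ ∀ j k, β j (s j) = β k (s k)

theorem IsFactorization.exists_corners (hd : 2 ≤ d)
    (hq : ∀ i j, i ≠ j → Nat.Coprime (q i) (q j)) (h : IsFactorization q B N f g) :
    ∃ α β, Corners q N f g α β := by
  choose α hα β hβ hadd using h.exists_corner
  have hd0 : 0 < d := by omega
  have key : ∀ s : Fin d → ℤˣ, ∃ f₀ g₀ m n, IsInitial (sgn s) (lift q f) f₀ m ∧
      IsInitial (sgn s) (lift q g) g₀ n ∧ (NonVanishing f₀ ∨ NonVanishing g₀) ∧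
      ∀ j, wt (sgn s) (α j (s j)) = m ∧ wt (sgn s) (β j (s j)) = n := by
    intro s
    have hs := isSign_sgn s
    obtain ⟨f₀, m, hf⟩ := exists_isInitial (sgn s) (lift_ne_zero (q := q) (h.ne_zero hd0))
    obtain ⟨g₀, n, hg⟩ := exists_isInitial (sgn s) (lift_ne_zero (q := q) (h.symm.ne_zero hd0))
    obtain ⟨hmn, hprod⟩ := h.initial hs.isUnitWeight (hs.ne_zero ⟨0, hd0⟩) hf hg
    refine ⟨f₀, g₀, m, n, hf, hg, hs.nonVanishing_or hd hq hf.eval_rotate hg.eval_rotate hprod,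
      fun j => ?_⟩
    have h1 := hf.le_wt _ (hα j (s j))
    have h2 := hg.le_wt _ (hβ j (s j))
    have h3 : wt (sgn s) (α j (s j)) + wt (sgn s) (β j (s j)) = m + n := by
      rw [hmn, wt, wt, ← sum_add_distrib]
      simp_rw [← add_mul, hadd, sub_mul, sum_sub_distrib, mul_assoc, ← mul_sum, ite_mul, zero_mul]
      rw [sum_ite_eq' univ j, if_pos (mem_univ _), mul_right_comm]
      have := hs.mul_self j
      rw [sgn] at this
      rw [sgn, this, one_mul]
    constructor <;> omega
  have mono : ∀ {f f₀ : MvPolynomial (Fin d) ℂ} {s m} {α : Fin d → ℤˣ → Fin d →₀ ℕ},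
      IsInitial (sgn s) f f₀ m → NonVanishing f₀ → (∀ j σ, α j σ ∈ f.support) →
      (∀ j, wt (sgn s) (α j (s j)) = m) → ∀ j k, α j (s j) = α k (s k) := by
    intro f f₀ s m α hf hn hα hm
    obtain ⟨a, c, -, rfl⟩ := hn.exists_monomial
    have : ∀ j, α j (s j) = a := fun j =>
      mem_singleton.1 (support_monomial_subset (hf.mem_support_of_wt (hα _ _) (hm j)))
    exact fun j k => (this j).trans (this k).symm
  refine ⟨α, β, hadd, fun s j a ha => ?_, fun s j b hb => ?_, fun s => ?_⟩ <;>
    obtain ⟨f₀, g₀, m, n, hf, hg, hn, hm⟩ := key s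
  · exact (hm j).1.trans_le (hf.le_wt a ha)
  · exact (hm j).2.trans_le (hg.le_wt b hb)
  · exact hn.imp (fun hn => mono hf hn hα fun j => (hm j).1)
      fun hn => mono hg hn hβ fun j => (hm j).2

variable {α β : Fin d → ℤˣ → Fin d →₀ ℕ}

lemma Corners.symm (h : Corners q N f g α β) : Corners q N g f β α :=
  ⟨fun j σ i => by rw [add_comm, h.add_eq], h.right_le, h.left_le, fun s => (h.eq_or_eq s).symm⟩

lemma Corners.ne_or_ne (h : Corners q N f g α β) {j k : Fin d} (hjk : j ≠ k) {σ τ : ℤˣ}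
    (hα : α j σ = α k τ) : β j σ ≠ β k τ := by
  intro hβ
  have h1 := h.add_eq j σ j
  rw [hα, hβ, h.add_eq, if_neg hjk, if_pos rfl] at h1
  have h2 : (σ : ℤ) * Fintype.card (Cell q) = 0 := by linarith
  exact mul_ne_zero σ.ne_zero (by exact_mod_cast Fintype.card_ne_zero) h2

/-- A polynomial one of whose exponents is minimal for all sign vectors is a monomial. -/
lemma nonVanishing_of_le {p : MvPolynomial (Fin d) ℂ} (hp : p ≠ 0) {a : Fin d →₀ ℕ}
    (h : ∀ s, ∀ b ∈ p.support, wt (sgn s) a ≤ wt (sgn s) b) : NonVanishing p := by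
  have huniq : ∀ b ∈ p.support, b = a := by
    intro b hb
    have h1 := h (fun j => if a j ≤ b j then -1 else 1) b hb
    have h2 : ∑ j, |(b j : ℤ) - a j| ≤ 0 := by
      have : ∀ j, |(b j : ℤ) - a j| =
          a j * sgn (fun j => if a j ≤ b j then -1 else 1) j -
            b j * sgn (fun j => if a j ≤ b j then -1 else 1) j := by
        intro j
        simp only [sgn]
        split_ifs with hj
        · rw [abs_of_nonneg (by omega)]
          push_cast
          ring
        · rw [abs_of_nonpos (by omega)]
          push_cast
          ring
      simp_rw [this, sum_sub_distrib]
      unfold wt at h1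
      linarith
    have h3 := (sum_eq_zero_iff_of_nonneg fun j _ => abs_nonneg _).1
      (le_antisymm h2 (sum_nonneg fun j _ => abs_nonneg _))
    ext j
    have := abs_eq_zero.1 (h3 j (mem_univ j))
    omega
  have hsupp : p.support ⊆ {a} := fun b hb => mem_singleton.2 (huniq b hb)
  obtain ⟨b, hb⟩ := support_nonempty.2 hp
  have hab := huniq b hb
  subst hab
  intro w hw
  rw [eval_eq', sum_subset hsupp fun c _ hc => by rw [notMem_support_iff.1 hc, zero_mul],
    sum_singleton]
  exact mul_ne_zero (mem_support_iff.1 hb)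
    (Finset.prod_ne_zero_iff.2 fun j _ => pow_ne_zero _ (hw j))

/-- In dimension at least three the Floquet determinant has only trivial factorizations. -/
theorem IsFactorization.nonVanishing_or (hd : 3 ≤ d)
    (hq : ∀ i j, i ≠ j → Nat.Coprime (q i) (q j)) (h : IsFactorization q B N f g) :
    NonVanishing f ∨ NonVanishing g := by
  obtain ⟨α, β, hc⟩ := h.exists_corners (by omega) hq
  have key : ∀ {f g : MvPolynomial (Fin d) ℂ} {α β}, f ≠ 0 → Corners q N f g α β →
      (∀ j k, α j 1 = α k 1) → NonVanishing f := by
    intro f g α β hf hc h1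
    have step : ∀ (s : Fin d → ℤˣ) i σ, (∀ j k, α j (s j) = α k (s k)) →
        ∀ j k, α j (Function.update s i σ j) = α k (Function.update s i σ k) := by
      intro s i σ hs
      refine (hc.eq_or_eq _).resolve_right fun hβ => ?_
      obtain ⟨j, k, hj, hk, hjk⟩ : ∃ j k, j ≠ i ∧ k ≠ i ∧ j ≠ k := by
        have hcard : 1 < (univ.erase i).card := by
          rw [card_erase_of_mem (mem_univ i), card_univ, Fintype.card_fin]
          omega
        obtain ⟨j, hj, k, hk, hjk⟩ := one_lt_card.1 hcard
        exact ⟨j, k, ne_of_mem_erase hj, ne_of_mem_erase hk, hjk⟩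
      have := hβ j k
      rw [Function.update_of_ne hj, Function.update_of_ne hk] at this
      exact hc.ne_or_ne hjk (hs j k) this
    have all : ∀ s : Fin d → ℤˣ, ∀ j k, α j (s j) = α k (s k) := by
      intro s
      have : ∀ t : Finset (Fin d), ∀ j k, α j (t.piecewise s 1 j) = α k (t.piecewise s 1 k) := by
        intro t
        induction t using Finset.induction_on with
        | empty => simpa using h1
        | insert i t _ ih =>
          rw [piecewise_insert]
          exact step _ _ _ ih
      simpa using this univ
    have hd0 : 0 < d := by omega
    have hconst : ∀ j σ, α j σ = α ⟨0, hd0⟩ 1 := by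
      have hne : ∀ j k σ τ, j ≠ k → α j σ = α k τ := by
        intro j k σ τ hjk
        have := all (Function.update (fun _ => τ) j σ) j k
        rwa [Function.update_self, Function.update_of_ne hjk.symm] at this
      intro j σ
      obtain ⟨k, hk⟩ : ∃ k, k ∉ ({j, ⟨0, hd0⟩} : Finset (Fin d)) := by
        by_contra! hall
        have := (card_le_card fun k (_ : k ∈ univ) => hall k).trans card_le_two
        rw [card_univ, Fintype.card_fin] at this
        omega
      simp only [mem_insert, mem_singleton, not_or] at hk
      exact (hne _ _ σ 1 (Ne.symm hk.1)).trans (hne _ _ 1 1 hk.2)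
    refine nonVanishing_lift_iff.1 (nonVanishing_of_le (lift_ne_zero (q := q) hf)
      (a := α ⟨0, hd0⟩ 1) fun s b hb => ?_)
    have := hc.left_le s ⟨0, hd0⟩ b hb
    rwa [hconst] at this
  exact (hc.eq_or_eq 1).imp (key (h.ne_zero (by omega)) hc)
    (key (h.symm.ne_zero (by omega)) hc.symm)

/-- A quasi-homogeneous factor has the same zeros as the leading part. -/
lemma IsFactorization.eval_eq_zero_iff (hd : 2 ≤ d)
    (hq : ∀ i j, i ≠ j → Nat.Coprime (q i) (q j)) (h : IsFactorization q B N f g)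
    (hf : ¬ NonVanishing f) {s : Fin d → ℤˣ} {m : ℤ}
    (hm : ∀ a ∈ (lift q f).support, wt (sgn s) a = m) {w : Fin d → ℂ} (hw : w ∈ torus d) :
    eval (cover q w) f = 0 ↔ leading q (sgn s) w = 0 := by
  have hd0 : 0 < d := by omega
  have hs := isSign_sgn s
  have hf₀ : IsInitial (sgn s) (lift q f) (lift q f) m := by
    refine ⟨lift_ne_zero (h.ne_zero hd0), fun a ha => (hm a ha).ge, fun a => ?_⟩
    split_ifs with ha
    · rfl
    · exact notMem_support_iff.1 fun h => ha (hm a h)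
  obtain ⟨g₀, n, hg⟩ := exists_isInitial (sgn s) (lift_ne_zero (q := q) (h.symm.ne_zero hd0))
  have hprod := (h.initial hs.isUnitWeight (hs.ne_zero ⟨0, hd0⟩) hf₀ hg).2
  have hn := (hs.nonVanishing_or hd hq hf₀.eval_rotate hg.eval_rotate hprod).resolve_left
    fun h => hf (nonVanishing_lift_iff.1 h)
  have h1 := hprod w hw
  rw [eval_lift] at h1
  constructor
  · intro h0
    rw [h0, zero_mul, eq_comm, mul_eq_zero] at h1
    exact h1.resolve_left (pow_ne_zero _ (prod_ne_zero_of_mem (cover_mem hw)))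
  · intro h0
    rw [h0, mul_zero, mul_eq_zero] at h1
    exact h1.resolve_right (hn w hw)

end Corners

section Plane

variable {q : Fin 2 → ℕ+} {B : Matrix (Cell q) (Cell q) ℂ} {N : ℕ}
  {f g : MvPolynomial (Fin 2) ℂ} {α β : Fin 2 → ℤˣ → Fin 2 →₀ ℕ}

lemma Corners.nonVanishing_left (h : Corners q N f g α β) (hf : f ≠ 0) {j : Fin 2}
    (hj : α j (-1) = α j 1) : NonVanishing f := by
  refine nonVanishing_lift_iff.1 (nonVanishing_of_le (lift_ne_zero (q := q) hf) (a := α j 1)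
    fun s b hb => ?_)
  have := h.left_le s j b hb
  rcases Int.units_eq_one_or (s j) with hs | hs
  · rwa [hs] at this
  · rwa [hs, hj] at this

lemma Corners.wt_eq (h : Corners q N f g α β) {σ τ : ℤˣ} (hα : α 0 σ = α 1 τ) :
    ∀ a ∈ (lift q f).support, wt (sgn ![σ, -τ]) a = wt (sgn ![σ, -τ]) (α 0 σ) := by
  intro a ha
  have h1 := h.left_le ![σ, -τ] 0 a ha
  have h2 := h.left_le (-![σ, -τ]) 1 a ha
  rw [wt_neg_sgn, wt_neg_sgn] at h2
  simp only [Pi.neg_apply, Matrix.cons_val_zero, Matrix.cons_val_one, neg_neg] at h1 h2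
  rw [← hα] at h2
  linarith

/-- In dimension two the factors of a nontrivial factorization are quasi-homogeneous. -/
theorem IsFactorization.exists_sign (hq : ∀ i j, i ≠ j → Nat.Coprime (q i) (q j))
    (h : IsFactorization q B N f g) (hf : ¬ NonVanishing f) (hg : ¬ NonVanishing g) :
    ∃ τ : ℤˣ, (∀ w ∈ torus 2, eval (cover q w) f = 0 ↔ leading q (sgn ![1, τ]) w = 0) ∧
      ∀ w ∈ torus 2, eval (cover q w) g = 0 ↔ leading q (sgn ![1, -τ]) w = 0 := by
  obtain ⟨α, β, hc⟩ := h.exists_corners le_rfl hq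
  have hα : ∀ j, α j (-1) ≠ α j 1 := fun j hj =>
    hf (hc.nonVanishing_left (h.ne_zero two_pos) hj)
  have hβ : ∀ j, β j (-1) ≠ β j 1 := fun j hj =>
    hg (hc.symm.nonVanishing_left (h.symm.ne_zero two_pos) hj)
  have e : ∀ σ τ : ℤˣ, α 0 σ = α 1 τ ∨ β 0 σ = β 1 τ := fun σ τ =>
    (hc.eq_or_eq ![σ, τ]).imp (fun h => h 0 1) fun h => h 0 1
  rcases e 1 1 with h1 | h1
  · have h2 := (e 1 (-1)).resolve_left fun h2 => hα 1 (h2.symm.trans h1)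
    exact ⟨-1, fun w hw => h.eval_eq_zero_iff le_rfl hq hf (hc.wt_eq h1) hw, fun w hw =>
      h.symm.eval_eq_zero_iff le_rfl hq hg (hc.symm.wt_eq h2) hw⟩
  · have h2 := (e 1 (-1)).resolve_right fun h2 => hβ 1 (h2.symm.trans h1)
    refine ⟨1, fun w hw => ?_, fun w hw =>
      h.symm.eval_eq_zero_iff le_rfl hq hg (hc.symm.wt_eq h1) hw⟩
    have h3 := hc.wt_eq h2
    rw [neg_neg] at h3
    exact h.eval_eq_zero_iff le_rfl hq hf h3 hw

end Plane

end Floquet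

namespace Floquet

open Finset MvPolynomial Filter Topology
open Matrix (diagonal det)

section Variety

variable {d : ℕ} {q : Fin d → ℕ+} {N : ℕ} {V : (Fin d → ℤ) → ℂ} {lam : ℂ}
  {P f g : MvPolynomial (Fin d) ℂ}

lemma isCleared_scriptP (q : Fin d → ℕ+) (V : (Fin d → ℤ) → ℂ) (lam : ℂ) :
    IsCleared fun z => scriptP q V z lam := by
  have hext : ∀ (u : Cell q → ℂ) n, IsCleared fun z => extendBC q z u n := fun u n =>
    (isCleared_prod _ fun j _ => isCleared_zpow_apply j _).mul (isCleared_const _)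
  have hlap : ∀ (u : Cell q → ℂ) n, IsCleared fun z => discLap (extendBC q z u) n := fun u n =>
    isCleared_sum _ fun j _ => (hext u _).add (hext u _)
  refine isCleared_det fun n n' => ?_
  have h := (((isCleared_const (-1)).mul (hlap (Pi.single n' 1) fun j => ((n j : ℕ) : ℤ))).add
    (isCleared_const (V (fun j => ((n j : ℕ) : ℤ)) * (if n = n' then 1 else 0)))).add
    (isCleared_const (-(lam • (1 : Matrix (Cell q) (Cell q) ℂ)) n n'))
  simpa [DVmat, sub_eq_add_neg] using h

/-- `P` is a polynomial representing the Floquet determinant. -/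
structure Represents (q : Fin d → ℕ+) (V : (Fin d → ℤ) → ℂ) (lam : ℂ) (N : ℕ)
    (P : MvPolynomial (Fin d) ℂ) : Prop where
  card_le : Fintype.card (Cell q) ≤ N
  eval_eq : ∀ z ∈ torus d, eval z P = (∏ j, z j) ^ N * scriptP q V z lam

lemma exists_represents (q : Fin d → ℕ+) (V : (Fin d → ℤ) → ℂ) (lam : ℂ) :
    ∃ N P, Represents q V lam N P := by
  obtain ⟨N, P, hN, hP⟩ := (isCleared_scriptP q V lam).exists_ge (Fintype.card (Cell q))
  exact ⟨N, P, hN, hP⟩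

lemma Represents.floquetVariety_eq (h : Represents q V lam N P) :
    FloquetVariety q V lam = {z | z ∈ torus d ∧ eval z P = 0} := by
  ext z
  refine and_congr_right fun hz => ?_
  rw [h.eval_eq z hz, mul_eq_zero, or_iff_right (pow_ne_zero _ (prod_ne_zero_of_mem hz))]

lemma Represents.isFactorization (h : Represents q V lam N P) (hP : P = f * g) :
    IsFactorization q (potMat q V - lam • (1 : Matrix (Cell q) (Cell q) ℂ)) N f g :=
  ⟨h.card_le, fun w hw => by
    rw [← map_mul, ← hP, h.eval_eq _ (cover_mem hw), scriptP_cover hw]⟩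

lemma Represents.ne_zero (hd : 0 < d) (h : Represents q V lam N P) : P ≠ 0 :=
  (h.isFactorization (mul_one P).symm).ne_zero hd

lemma Represents.not_nonVanishing (hd : 0 < d) (h : Represents q V lam N P) :
    ¬ NonVanishing P := by
  intro hn
  obtain ⟨a, c, -, hac⟩ := (nonVanishing_lift_iff (q := q).2 hn).exists_monomial
  have key : ∀ σ : ℤˣ, (a ⟨0, hd⟩ : ℤ) =
      N * (q ⟨0, hd⟩ : ℕ) - (σ : ℤ) * Fintype.card (Cell q) := by
    intro σ
    obtain ⟨b, hb, b', hb', hadd⟩ := (h.isFactorization (mul_one P).symm).exists_corner ⟨0, hd⟩ σ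
    rw [hac] at hb
    rw [lift, map_one, support_one, mem_singleton] at hb'
    have := hadd ⟨0, hd⟩
    rw [mem_singleton.1 (support_monomial_subset hb), hb', if_pos rfl] at this
    simpa using this
  have h1 := key 1
  rw [key (-1)] at h1
  have : 0 < Fintype.card (Cell q) := Fintype.card_pos_iff.2 ⟨fun j => ⟨0, (q j).pos⟩⟩
  push_cast at h1
  omega

end Variety

section Components

variable {d : ℕ}

lemma isAlgSubset_eval_eq_zero (f : MvPolynomial (Fin d) ℂ) :
    IsAlgSubset {z | z ∈ torus d ∧ eval z f = 0} :=
  ⟨1, fun _ z => eval z f, fun _ => isLaurent_eval f, by simp [torus]⟩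

lemma isAlgSubset_inter {S T : Set (Fin d → ℂ)} (hS : IsAlgSubset S) (hT : IsAlgSubset T) :
    IsAlgSubset (S ∩ T) := by
  obtain ⟨m, f, hf, rfl⟩ := hS
  obtain ⟨n, g, hg, rfl⟩ := hT
  refine ⟨m + n, Fin.append f g, fun i => ?_, ?_⟩
  · refine Fin.addCases (fun i => ?_) (fun i => ?_) i
    · rw [Fin.append_left]
      exact hf i
    · rw [Fin.append_right]
      exact hg i
  · ext z
    constructor
    · rintro ⟨⟨hz, h1⟩, -, h2⟩
      refine ⟨hz, fun i => Fin.addCases (fun i => ?_) (fun i => ?_) i⟩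
      · rw [Fin.append_left]
        exact h1 i
      · rw [Fin.append_right]
        exact h2 i
    · rintro ⟨hz, h⟩
      refine ⟨⟨hz, fun i => ?_⟩, hz, fun i => ?_⟩
      · simpa using h (Fin.castAdd n i)
      · simpa using h (Fin.natAdd m i)

lemma AlgIrreducible.subset_or_subset {S₁ S₂ T : Set (Fin d → ℂ)} (h₁ : IsAlgSubset S₁)
    (h₂ : IsAlgSubset S₂) (hT : IsAlgSubset T) (hirr : AlgIrreducible T) (h : T ⊆ S₁ ∪ S₂) :
    T ⊆ S₁ ∨ T ⊆ S₂ := by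
  refine (hirr.2 (T ∩ S₁) (T ∩ S₂) (isAlgSubset_inter hT h₁) (isAlgSubset_inter hT h₂)
    Set.inter_subset_left Set.inter_subset_left ?_).imp Set.inter_eq_left.1 Set.inter_eq_left.1
  rw [← Set.inter_union_distrib_left, Set.inter_eq_left.2 h]

/-- A union of two incomparable irreducible sets has these sets as its components. -/
lemma components_union {S₁ S₂ : Set (Fin d → ℂ)} (h₁ : IsAlgSubset S₁) (h₂ : IsAlgSubset S₂)
    (hi₁ : AlgIrreducible S₁) (hi₂ : AlgIrreducible S₂) (h₁₂ : ¬ S₁ ⊆ S₂) (h₂₁ : ¬ S₂ ⊆ S₁) :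
    IsIrredComponent (S₁ ∪ S₂) S₁ ∧ IsIrredComponent (S₁ ∪ S₂) S₂ ∧ S₁ ≠ S₂ ∧
      ∀ T, IsIrredComponent (S₁ ∪ S₂) T → T = S₁ ∨ T = S₂ := by
  refine ⟨⟨h₁, hi₁, Set.subset_union_left, fun T hT hTi hTS hST => ?_⟩,
    ⟨h₂, hi₂, Set.subset_union_right, fun T hT hTi hTS hST => ?_⟩, fun h => h₁₂ h.subset,
    fun T ⟨hT, hTi, hTS, hmax⟩ => ?_⟩
  · rcases AlgIrreducible.subset_or_subset h₁ h₂ hT hTi hTS with h | h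
    · exact hST.antisymm h
    · exact absurd (hST.trans h) h₁₂
  · rcases AlgIrreducible.subset_or_subset h₁ h₂ hT hTi hTS with h | h
    · exact absurd (hST.trans h) h₂₁
    · exact hST.antisymm h
  · exact (AlgIrreducible.subset_or_subset h₁ h₂ hT hTi hTS).imp
      (hmax _ h₁ hi₁ Set.subset_union_left) (hmax _ h₂ hi₂ Set.subset_union_right)

end Components

section Plane

variable {q : Fin 2 → ℕ+}

/-- The parametrization of a branch of the Floquet variety. -/
def branch (τ : ℤˣ) (t : ℂ) : Fin 2 → ℂ := ![t, -t ^ (τ : ℤ)]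

lemma branch_mem (τ : ℤˣ) {t : ℂ} (ht : t ≠ 0) : branch τ t ∈ torus 2 := by
  intro j
  fin_cases j
  · exact ht
  · exact neg_ne_zero.2 (zpow_ne_zero _ ht)

lemma leading_branch (τ : ℤˣ) (t : ℂ) :
    leading q (sgn ![1, τ]) (branch τ t) = 0 := by
  refine prod_eq_zero (mem_univ fun j => ⟨0, (q j).pos⟩) ?_
  simp only [rho_zero, one_mul, Fin.sum_univ_two, sgn, branch, Matrix.cons_val_zero, Matrix.cons_val_one]
  rcases Int.units_eq_one_or τ with rfl | rfl <;> simp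

lemma exists_cover_branch {τ : ℤˣ} {w : Fin 2 → ℂ} (hw : w ∈ torus 2)
    (h : leading q (sgn ![1, τ]) w = 0) : ∃ t ≠ 0, cover q w = cover q (branch τ t) := by
  obtain ⟨m, -, hm⟩ := Finset.prod_eq_zero_iff.1 h
  have hr := rotate_mem m hw
  refine ⟨rotate m w 0, hr 0, ?_⟩
  rw [← cover_rotate m w]
  congr 1
  have hs := fun j => (isSign_sgn ![1, τ]).ne_zero j
  rw [Fin.sum_univ_two, if_neg (hs 0), if_neg (hs 1), neg_eq_zero] at hm
  change rotate m w 0 ^ (-((1 : ℤˣ) : ℤ)) + rotate m w 1 ^ (-(τ : ℤ)) = 0 at hm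
  have h0 := hr 0
  have h1 := hr 1
  funext j
  fin_cases j
  · rfl
  · change rotate m w 1 = -rotate m w 0 ^ (τ : ℤ)
    rcases Int.units_eq_one_or τ with rfl | rfl
    · simp only [Units.val_one, zpow_neg_one, zpow_one] at hm ⊢
      field_simp at hm
      linear_combination hm
    · simp only [Units.val_one, zpow_neg_one, zpow_one, Units.val_neg, neg_neg] at hm ⊢
      linear_combination hm

lemma setOf_eval_eq_zero {τ : ℤˣ} {f : MvPolynomial (Fin 2) ℂ}
    (h : ∀ w ∈ torus 2, eval (cover q w) f = 0 ↔ leading q (sgn ![1, τ]) w = 0) :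
    {z | z ∈ torus 2 ∧ eval z f = 0} = {z | ∃ t ≠ 0, z = cover q (branch τ t)} := by
  ext z
  constructor
  · rintro ⟨hz, h0⟩
    obtain ⟨w, hw, rfl⟩ := exists_cover_eq (q := q) hz
    exact exists_cover_branch hw ((h w hw).1 h0)
  · rintro ⟨t, ht, rfl⟩
    exact ⟨cover_mem (branch_mem τ ht), (h _ (branch_mem τ ht)).2 (leading_branch τ t)⟩

lemma algIrreducible_branch (q : Fin 2 → ℕ+) (τ : ℤˣ) :
    AlgIrreducible {z | ∃ t ≠ 0, z = cover q (branch τ t)} := by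
  refine algIrreducible_of_mul ⟨_, 1, one_ne_zero, rfl⟩ ?_ fun p r hpr => ?_
  · rintro _ ⟨t, ht, rfl⟩
    exact cover_mem (branch_mem τ ht)
  have hcl : ∀ p : MvPolynomial (Fin 2) ℂ,
      IsCleared fun u : Fin 1 → ℂ => eval (cover q (branch τ (u 0))) p := by
    intro p
    simp_rw [eval_eq']
    refine isCleared_sum _ fun a _ => (isCleared_const _).mul (isCleared_prod _ fun j _ =>
      IsCleared.pow (IsCleared.pow ?_ _) _)
    fin_cases j
    · exact isCleared_apply 0
    · simpa [branch] using (isCleared_const (-1)).mul (isCleared_zpow_apply (0 : Fin 1) (τ : ℤ))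
  obtain ⟨N, p', hp⟩ := hcl p
  obtain ⟨M, r', hr⟩ := hcl r
  have hmul : p' * r' = 0 := eq_of_eval_torus fun u hu => by
    rw [map_mul, hp u hu, hr u hu, map_zero]
    linear_combination (∏ j, u j) ^ N * (∏ j, u j) ^ M * hpr _ ⟨u 0, hu 0, rfl⟩
  have back : ∀ {p : MvPolynomial (Fin 2) ℂ} {p' : MvPolynomial (Fin 1) ℂ} {N : ℕ},
      (∀ u ∈ torus 1, eval u p' = (∏ j, u j) ^ N * eval (cover q (branch τ (u 0))) p) →
      p' = 0 → ∀ z ∈ {z | ∃ t ≠ 0, z = cover q (branch τ t)}, eval z p = 0 := by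
    rintro p p' N hp rfl _ ⟨t, ht, rfl⟩
    have hu : (fun _ => t : Fin 1 → ℂ) ∈ torus 1 := fun _ => ht
    have := hp _ hu
    rw [map_zero, eq_comm, mul_eq_zero] at this
    exact this.resolve_left (pow_ne_zero _ (prod_ne_zero_of_mem hu))
  exact (mul_eq_zero.1 hmul).imp (back hp) (back hr)

lemma not_branch_subset (q : Fin 2 → ℕ+) (τ : ℤˣ) :
    ¬ {z | ∃ t ≠ 0, z = cover q (branch τ t)} ⊆ {z | ∃ t ≠ 0, z = cover q (branch (-τ) t)} := by
  intro h
  obtain ⟨t, ht, heq⟩ := h ⟨2, two_ne_zero, rfl⟩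
  have hnorm : ∀ j, ‖branch τ 2 j‖ = ‖branch (-τ) t j‖ := by
    intro j
    have := congrArg norm (congrFun heq j)
    simp only [cover, norm_pow] at this
    exact (pow_left_inj₀ (norm_nonneg _) (norm_nonneg _) (q j).ne_zero).1 this
  have h0 := hnorm 0
  have h1 := hnorm 1
  simp only [branch, Matrix.cons_val_zero, Matrix.cons_val_one, norm_neg, norm_zpow] at h0 h1
  rw [← h0] at h1
  rcases Int.units_eq_one_or τ with rfl | rfl <;> norm_num at h1

/-- If the determinant vanishes along the branch `w₁ + w₂ = 0` then the corner entry of the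
perturbation vanishes. -/
lemma eq_zero_of_det_branch (hq : Nat.Coprime (q 0) (q 1)) {B : Matrix (Cell q) (Cell q) ℂ}
    (h : ∀ t ≠ 0, det (Amat q (branch 1 t) + B) = 0) :
    B (fun j => ⟨0, (q j).pos⟩) (fun j => ⟨0, (q j).pos⟩) = 0 := by
  set o : Cell q := fun j => ⟨0, (q j).pos⟩ with ho
  let l : Cell q → ℂ := fun m => rho (q 1) (m 1) - rho (q 0) (m 0)
  let l' : Cell q → ℂ := fun m => (rho (q 1) (m 1))⁻¹ - (rho (q 0) (m 0))⁻¹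
  have hlo : l o = 0 := by simp [l, o, rho_zero]
  have hlo' : l' o = 0 := by simp [l', o, rho_zero]
  have hl : ∀ m, l m = 0 → m = o := by
    intro m hm
    have h01 : rho (q 1) (m 1) = rho (q 0) (m 0) := sub_eq_zero.1 hm
    have h1 : rho (q 0) (m 0) = 1 := by
      rw [← orderOf_eq_one_iff]
      exact Nat.eq_one_of_dvd_coprimes hq (orderOf_dvd_of_pow_eq_one (rho_pow_self _ _))
        (orderOf_dvd_of_pow_eq_one (h01 ▸ rho_pow_self _ _))
    funext j
    refine rho_injective (q j) ?_
    fin_cases j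
    · exact h1.trans (rho_zero _).symm
    · exact (h01.trans h1).trans (rho_zero _).symm
  let M : ℂ → Matrix (Cell q) (Cell q) ℂ := fun ε =>
    diagonal l + ε • B + ε ^ 2 • diagonal l'
  have hM : ∀ ε ≠ 0, M ε = ε • (Amat q (branch 1 ε⁻¹) + B) := by
    intro ε hε
    have : Amat q (branch 1 ε⁻¹) = ε⁻¹ • diagonal l + ε • diagonal l' := by
      rw [← Matrix.diagonal_smul, ← Matrix.diagonal_smul, Matrix.diagonal_add, Amat]
      congr 1
      funext m
      simp only [Fin.sum_univ_two, branch, Matrix.cons_val_zero, Matrix.cons_val_one, l, l',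
        Pi.smul_apply, smul_eq_mul, Units.val_one, zpow_one, mul_inv, inv_inv, inv_neg]
      ring
    rw [this, smul_add, smul_add, smul_smul, smul_smul, mul_inv_cancel₀ hε, one_smul, ← sq]
    simp only [M]
    abel
  have hrow : ∀ ε, M ε o = ε • B o := by
    intro ε
    funext m
    simp [M, Matrix.diagonal_apply, hlo, hlo']
  have hdet : ∀ ε ≠ 0, det ((M ε).updateRow o (B o)) = 0 := by
    intro ε hε
    have h1 : det (M ε) = 0 := by rw [hM ε hε, Matrix.det_smul, h _ (inv_ne_zero hε), mul_zero]
    rw [← Matrix.updateRow_eq_self (M ε) o, hrow, Matrix.det_updateRow_smul, mul_eq_zero] at h1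
    exact h1.resolve_left hε
  have hlim : det ((M 0).updateRow o (B o)) = 0 := by
    have hcont : Continuous fun ε => det ((M ε).updateRow o (B o)) := by
      refine Continuous.matrix_det (Continuous.matrix_updateRow o ?_ continuous_const)
      fun_prop
    have h1 := (hcont.tendsto 0).mono_left (nhdsWithin_le_nhds (s := {(0 : ℂ)}ᶜ))
    refine tendsto_nhds_unique h1 (tendsto_const_nhds.congr' ?_)
    filter_upwards [self_mem_nhdsWithin] with ε hε
    exact (hdet ε hε).symm
  obtain ⟨v, hv, hv0⟩ := Matrix.exists_mulVec_eq_zero_iff.2 hlim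
  have hvm : ∀ m, m ≠ o → v m = 0 := by
    intro m hm
    have := congrFun hv0 m
    rw [Matrix.mulVec, Matrix.updateRow_ne hm] at this
    simp only [M, zero_smul, add_zero, ne_eq, OfNat.ofNat_ne_zero, not_false_eq_true,
      zero_pow] at this
    change ((diagonal l).mulVec v) m = 0 at this
    rw [Matrix.mulVec_diagonal, mul_eq_zero] at this
    exact this.resolve_left fun h => hm (hl m h)
  have hvo : v o ≠ 0 := fun h => hv (funext fun m => by
    by_cases hm : m = o
    · rw [hm, h, Pi.zero_apply]
    · exact hvm m hm)
  have h2 := congrFun hv0 o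
  rw [Matrix.mulVec, Matrix.updateRow_self, dotProduct, sum_eq_single o
    (fun m _ hm => by rw [hvm m hm, mul_zero]) (by simp), Pi.zero_apply, mul_eq_zero] at h2
  exact h2.resolve_right hvo

variable {V : (Fin 2 → ℤ) → ℂ} {lam : ℂ} {N : ℕ} {P f g : MvPolynomial (Fin 2) ℂ}

lemma Represents.eq_avgPot (hq : ∀ i j, i ≠ j → Nat.Coprime (q i) (q j))
    (h : Represents q V lam N P) (hP : P = f * g) (hf : ¬ NonVanishing f)
    (hg : ¬ NonVanishing g) : lam = avgPot q V := by
  have hfac := h.isFactorization hP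
  obtain ⟨τ, hτf, hτg⟩ := hfac.exists_sign hq hf hg
  have hdet : ∀ t ≠ 0, det (Amat q (branch 1 t) +
      (potMat q V - lam • (1 : Matrix (Cell q) (Cell q) ℂ))) = 0 := by
    intro t ht
    have hb := branch_mem 1 ht
    have hmul := hfac.eval_mul _ hb
    have h0 : eval (cover q (branch 1 t)) f * eval (cover q (branch 1 t)) g = 0 := by
      rcases Int.units_eq_one_or τ with rfl | rfl
      · rw [(hτf _ hb).2 (leading_branch 1 t), zero_mul]
      · rw [neg_neg] at hτg
        rw [(hτg _ hb).2 (leading_branch 1 t), mul_zero]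
    rw [h0, eq_comm, mul_eq_zero] at hmul
    exact hmul.resolve_left (pow_ne_zero _ (prod_ne_zero_of_mem (cover_mem hb)))
  have hoo := eq_zero_of_det_branch (hq 0 1 (by decide)) hdet
  rw [Matrix.sub_apply, potMat_diag, Matrix.smul_apply, Matrix.one_apply_eq, smul_eq_mul,
    mul_one] at hoo
  exact (sub_eq_zero.1 hoo).symm

lemma Represents.exists_components (hq : ∀ i j, i ≠ j → Nat.Coprime (q i) (q j))
    (h : Represents q V lam N P) (hP : P = f * g) (hf : ¬ NonVanishing f)
    (hg : ¬ NonVanishing g) :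
    ∃ S₁ S₂, IsIrredComponent (FloquetVariety q V lam) S₁ ∧
      IsIrredComponent (FloquetVariety q V lam) S₂ ∧ S₁ ≠ S₂ ∧
      ∀ T, IsIrredComponent (FloquetVariety q V lam) T → T = S₁ ∨ T = S₂ := by
  obtain ⟨τ, hτf, hτg⟩ := (h.isFactorization hP).exists_sign hq hf hg
  have hvar : FloquetVariety q V lam =
      {z | z ∈ torus 2 ∧ eval z f = 0} ∪ {z | z ∈ torus 2 ∧ eval z g = 0} := by
    rw [h.floquetVariety_eq, hP]
    ext z
    simp only [map_mul, mul_eq_zero, Set.mem_ofPred_eq, Set.mem_union, and_or_left]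
  have h₁ := isAlgSubset_eval_eq_zero f
  have h₂ := isAlgSubset_eval_eq_zero g
  rw [setOf_eval_eq_zero hτf] at hvar h₁
  rw [setOf_eval_eq_zero hτg] at hvar h₂
  rw [hvar]
  have hnot := not_branch_subset q (-τ)
  rw [neg_neg] at hnot
  exact ⟨_, _, components_union h₁ h₂ (algIrreducible_branch q τ) (algIrreducible_branch q (-τ))
    (not_branch_subset q τ) hnot⟩

end Plane

end Floquet

/-- For `d ≥ 3`, the Floquet variety `𝓕_λ(V)` is an irreducible
algebraic subset of `(ℂ∖{0})^d` for every `λ ∈ ℂ`.  For `d = 2`, it is irreducible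
for every `λ ≠ [V]`, and if `𝓕_{[V]}(V)` is reducible then it has exactly two
irreducible components. -/
theorem statement6 (d : ℕ) (q : Fin d → ℕ+)
    (hq : ∀ i j, i ≠ j → Nat.Coprime (q i) (q j))
    (V : (Fin d → ℤ) → ℂ) (hV : IsPeriodic q V) :
    (3 ≤ d → ∀ lam : ℂ, AlgIrreducible (FloquetVariety q V lam)) ∧
    (d = 2 →
      (∀ lam : ℂ, lam ≠ avgPot q V → AlgIrreducible (FloquetVariety q V lam)) ∧
      (¬ AlgIrreducible (FloquetVariety q V (avgPot q V)) →
        ∃ S₁ S₂ : Set (Fin d → ℂ),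
          IsIrredComponent (FloquetVariety q V (avgPot q V)) S₁ ∧
          IsIrredComponent (FloquetVariety q V (avgPot q V)) S₂ ∧
          S₁ ≠ S₂ ∧
          ∀ T : Set (Fin d → ℂ),
            IsIrredComponent (FloquetVariety q V (avgPot q V)) T → T = S₁ ∨ T = S₂)) := by
  refine ⟨fun hd lam => ?_, ?_⟩
  · obtain ⟨N, P, h⟩ := Floquet.exists_represents q V lam
    rw [h.floquetVariety_eq]
    exact Floquet.algIrreducible_of_factor (h.ne_zero (by omega)) (h.not_nonVanishing (by omega))
      fun f g hP => (h.isFactorization hP).nonVanishing_or hd hq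
  · rintro rfl
    refine ⟨fun lam hlam => ?_, fun hred => ?_⟩
    · obtain ⟨N, P, h⟩ := Floquet.exists_represents q V lam
      rw [h.floquetVariety_eq]
      refine Floquet.algIrreducible_of_factor (h.ne_zero two_pos) (h.not_nonVanishing two_pos)
        fun f g hP => ?_
      by_contra! hfg
      exact hlam (h.eq_avgPot hq hP hfg.1 hfg.2)
    · obtain ⟨N, P, h⟩ := Floquet.exists_represents q V (avgPot q V)
      have hfac : ¬ ∀ f g, P = f * g → Floquet.NonVanishing f ∨ Floquet.NonVanishing g := by
        intro hfac
        rw [h.floquetVariety_eq] at hred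
        exact hred (Floquet.algIrreducible_of_factor (h.ne_zero two_pos)
          (h.not_nonVanishing two_pos) hfac)
      push Not at hfac
      obtain ⟨f, g, hP, hf, hg⟩ := hfac
      exact h.exists_components hq hP hf hg

end
end
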